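/- arXiv:1705.09949 — 12 statements merged into one kernel-verified Lean document; each statement's English description precedes it below -/
import Mathlib

section
/- Let ħ > 0 and let V be a real symmetric 2n×2n block matrix with n×n blocks V = [[A, C], [Cᵀ, B]]. Let Ω = [[0, ħ·I], [−ħ·I, 0]] (a real 2n×2n block matrix). Then the complex matrix V + (i/2)Ω is positive semidefinite if and only if the complex matrix V − (i/2)Ω is positive semidefinite; and, in that case, V is positive semidefinite and both A and B are positive definite. -/
open Matrix ComplexOrder

/-- The real `2n × 2n` block matrix `Ω = [[0, hbar·I], [−hbar·I, 0]]`, viewed as a complex matrix. -/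
noncomputable def OmegaC (hbar : ℝ) (n : ℕ) : Matrix (Fin n ⊕ Fin n) (Fin n ⊕ Fin n) ℂ :=
  Matrix.fromBlocks 0 ((hbar : ℂ) • 1) (-((hbar : ℂ) • 1)) 0

/-- The real symmetric block matrix `V = [[A, C], [Cᵀ, B]]`, viewed as a complex matrix. -/
noncomputable def VC {n : ℕ} (A C B : Matrix (Fin n) (Fin n) ℝ) :
    Matrix (Fin n ⊕ Fin n) (Fin n ⊕ Fin n) ℂ :=
  (Matrix.fromBlocks A C Cᵀ B).map Complex.ofReal

theorem posSemidef_of_map_ofReal {m : Type*} [Fintype m] {M : Matrix m m ℝ}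
    (h : (M.map Complex.ofReal).PosSemidef) : M.PosSemidef := by
  refine PosSemidef.of_dotProduct_mulVec_nonneg ?_ fun x => ?_
  · ext i j
    have hij := congrFun (congrFun h.isHermitian i) j
    simpa using hij
  · have hx := h.dotProduct_mulVec_nonneg (fun i => (x i : ℂ))
    have heq : star (fun i => (x i : ℂ)) ⬝ᵥ (M.map Complex.ofReal *ᵥ fun i => (x i : ℂ)) =
        ((star x ⬝ᵥ (M *ᵥ x) : ℝ) : ℂ) := by
      simp [dotProduct, mulVec]
    rw [heq] at hx
    exact_mod_cast hx

theorem transpose_VC_add_OmegaC {n : ℕ} (hbar : ℝ) {A B : Matrix (Fin n) (Fin n) ℝ}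
    (C : Matrix (Fin n) (Fin n) ℝ) (hA : A.IsSymm) (hB : B.IsSymm) :
    (VC A C B + (Complex.I / 2) • OmegaC hbar n)ᵀ =
      VC A C B - (Complex.I / 2) • OmegaC hbar n := by
  have hV : (VC A C B)ᵀ = VC A C B := by
    rw [VC, ← transpose_map, fromBlocks_transpose, hA.eq, hB.eq, transpose_transpose]
  have hΩ : (OmegaC hbar n)ᵀ = -OmegaC hbar n := by
    simp [OmegaC, fromBlocks_transpose, fromBlocks_neg]
  rw [transpose_add, transpose_smul, hV, hΩ, smul_neg, sub_eq_add_neg]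

/-- The Hermitian form of `V + (i/2)Ω` at the vector `(x, i y)` with `x`, `y` real. -/
theorem dotProduct_VC_add_OmegaC_mulVec {n : ℕ} (hbar : ℝ) (A B C : Matrix (Fin n) (Fin n) ℝ)
    (x y : Fin n → ℝ) :
    star (Sum.elim (fun i => (x i : ℂ)) (fun i => Complex.I * (y i : ℂ))) ⬝ᵥ
      ((VC A C B + (Complex.I / 2) • OmegaC hbar n) *ᵥ
        Sum.elim (fun i => (x i : ℂ)) (fun i => Complex.I * (y i : ℂ))) =
      ((x ⬝ᵥ (A *ᵥ x) + y ⬝ᵥ (B *ᵥ y) - hbar * (x ⬝ᵥ y) : ℝ) : ℂ) := by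
  have hmap (M : Matrix (Fin n) (Fin n) ℝ) (z : Fin n → ℝ) :
      M.map Complex.ofReal *ᵥ (fun i => (z i : ℂ)) = fun i => ((M *ᵥ z) i : ℂ) := by
    ext i
    simp [mulVec, dotProduct]
  have hdot (z w : Fin n → ℝ) :
      (fun i => (z i : ℂ)) ⬝ᵥ (fun i => (w i : ℂ)) = ((z ⬝ᵥ w : ℝ) : ℂ) := by
    simp [dotProduct]
  have hI : (fun i => Complex.I * (y i : ℂ)) = Complex.I • fun i => (y i : ℂ) := rfl
  have hstar : star (Sum.elim (fun i => (x i : ℂ)) (fun i => Complex.I * (y i : ℂ))) =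
      Sum.elim (fun i => (x i : ℂ)) (-Complex.I • fun i => (y i : ℂ)) := by
    ext (i | i) <;> simp
  have hC : y ⬝ᵥ (Cᵀ *ᵥ x) = x ⬝ᵥ (C *ᵥ y) := by
    rw [mulVec_transpose, dotProduct_comm, dotProduct_mulVec]
  rw [hstar, hI, VC, OmegaC, fromBlocks_map, add_mulVec, smul_mulVec, fromBlocks_mulVec,
    fromBlocks_mulVec]
  simp only [Sum.elim_comp_inl, Sum.elim_comp_inr, mulVec_smul, hmap, dotProduct_add,
    dotProduct_smul, sumElim_dotProduct_sumElim, smul_dotProduct, hdot, hC, zero_mulVec,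
    neg_mulVec, smul_mulVec, one_mulVec, dotProduct_neg, dotProduct_zero, smul_eq_mul,
    dotProduct_comm y x, zero_add]
  push_cast
  linear_combination (-((y ⬝ᵥ (B *ᵥ y) : ℝ) : ℂ) + hbar * ((x ⬝ᵥ y : ℝ) : ℂ)) * Complex.I_mul_I

theorem posDef_of_mul_dotProduct_le {n : ℕ} {c : ℝ} (hc : 0 < c)
    {A B : Matrix (Fin n) (Fin n) ℝ} (hA : A.IsSymm)
    (h : ∀ x y : Fin n → ℝ, c * (x ⬝ᵥ y) ≤ x ⬝ᵥ (A *ᵥ x) + y ⬝ᵥ (B *ᵥ y)) : A.PosDef := by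
  refine PosDef.of_dotProduct_mulVec_pos hA fun x hx => ?_
  rw [star_trivial]
  have hxx : 0 < x ⬝ᵥ x := by simpa using dotProduct_star_self_pos_iff.2 hx
  have hb : 0 ≤ x ⬝ᵥ (B *ᵥ x) := by simpa using h 0 x
  set b := x ⬝ᵥ (B *ᵥ x)
  set s := c * (x ⬝ᵥ x) with hs
  have hspos : 0 < s := mul_pos hc hxx
  have ht := h x ((s / (b + 1)) • x)
  simp only [dotProduct_smul, smul_dotProduct, mulVec_smul, smul_eq_mul] at ht
  have hlt : s / (b + 1) * (s / (b + 1) * b) < s / (b + 1) * s := by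
    refine mul_lt_mul_of_pos_left ?_ (by positivity)
    rw [div_mul_eq_mul_div, div_lt_iff₀ (by positivity)]
    nlinarith
  nlinarith

/-- `V + (i/2)Ω` is positive semidefinite iff `V − (i/2)Ω` is, and in that
case `V` is positive semidefinite and `A`, `B` are positive definite. -/
theorem stmt_2 {n : ℕ} (hbar : ℝ) (hhbar : 0 < hbar)
    (A B C : Matrix (Fin n) (Fin n) ℝ) (hA : A.IsSymm) (hB : B.IsSymm) :
    ((VC A C B + (Complex.I / 2) • OmegaC hbar n).PosSemidef ↔
      (VC A C B - (Complex.I / 2) • OmegaC hbar n).PosSemidef) ∧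
    ((VC A C B + (Complex.I / 2) • OmegaC hbar n).PosSemidef →
      (Matrix.fromBlocks A C Cᵀ B).PosSemidef ∧ A.PosDef ∧ B.PosDef) := by
  have htr := transpose_VC_add_OmegaC hbar C hA hB
  have hiff : (VC A C B + (Complex.I / 2) • OmegaC hbar n).PosSemidef ↔
      (VC A C B - (Complex.I / 2) • OmegaC hbar n).PosSemidef := by
    rw [← htr, posSemidef_transpose_iff]
  refine ⟨hiff, fun h => ?_⟩
  have key (x y : Fin n → ℝ) : hbar * (x ⬝ᵥ y) ≤ x ⬝ᵥ (A *ᵥ x) + y ⬝ᵥ (B *ᵥ y) := by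
    have hxy := h.dotProduct_mulVec_nonneg
      (Sum.elim (fun i => (x i : ℂ)) (fun i => Complex.I * (y i : ℂ)))
    rw [dotProduct_VC_add_OmegaC_mulVec] at hxy
    exact sub_nonneg.1 (by exact_mod_cast hxy)
  refine ⟨posSemidef_of_map_ofReal ?_, posDef_of_mul_dotProduct_le hhbar hA key,
    posDef_of_mul_dotProduct_le (B := A) hhbar hB fun x y => ?_⟩
  · have hsum := (h.add (hiff.1 h)).smul (show (0 : ℝ) ≤ 1 / 2 by norm_num)
    convert hsum using 1
    change VC A C B = _
    rw [add_add_sub_cancel, ← two_smul ℝ, smul_smul]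
    norm_num
  · rw [dotProduct_comm, add_comm]
    exact key y x
end

section
/- Let ħ > 0 and let V = [[A, C], [Cᵀ, B]] be a real symmetric 2n×2n block matrix, and Ω = [[0, ħ·I], [−ħ·I, 0]]. Then the complex matrix V + (i/2)Ω is positive semidefinite if and only if A is positive definite and the complex Hermitian matrix B − (Cᵀ − (iħ/2)I)·A⁻¹·(C + (iħ/2)I) is positive semidefinite. -/
open Matrix ComplexOrder

open scoped MatrixOrder in
theorem Matrix.PosSemidef.map_ofReal {m : Type*} [Fintype m] {A : Matrix m m ℝ}
    (hA : A.PosSemidef) : (A.map Complex.ofReal).PosSemidef := by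
  classical
  obtain ⟨S, rfl⟩ := CStarAlgebra.nonneg_iff_eq_star_mul_self.mp hA.nonneg
  have h : (star S * S).map Complex.ofReal =
      (S.map Complex.ofReal)ᴴ * S.map Complex.ofReal := by
    ext i j
    simp [Matrix.mul_apply, Matrix.star_eq_conjTranspose]
  rw [h]
  exact posSemidef_conjTranspose_mul_self _

theorem Matrix.map_ofReal_nonsing_inv {m : Type*} [Fintype m] [DecidableEq m]
    {A : Matrix m m ℝ} (hA : IsUnit A) :
    (A.map Complex.ofReal)⁻¹ = A⁻¹.map Complex.ofReal := by
  refine Matrix.inv_eq_right_inv ?_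
  have h : (A * A⁻¹).map Complex.ofReal = A.map Complex.ofReal * A⁻¹.map Complex.ofReal :=
    Matrix.map_mul (f := Complex.ofRealHom)
  rw [← h, Matrix.mul_nonsing_inv A ((Matrix.isUnit_iff_isUnit_det A).mp hA)]
  simp

theorem Matrix.PosDef.map_ofReal {m : Type*} [Fintype m] {A : Matrix m m ℝ}
    (hA : A.PosDef) : (A.map Complex.ofReal).PosDef := by
  classical
  exact hA.posSemidef.map_ofReal.posDef_iff_isUnit.mpr
    (hA.isUnit.map (Complex.ofRealHom.mapMatrix (m := m)))

theorem Matrix.ofReal_dotProduct_mulVec {m : Type*} [Fintype m] (A : Matrix m m ℝ) (x : m → ℝ) :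
    star (fun i => (x i : ℂ)) ⬝ᵥ (A.map Complex.ofReal *ᵥ fun i => (x i : ℂ)) =
      ((star x ⬝ᵥ (A *ᵥ x) : ℝ) : ℂ) := by
  simp [dotProduct, mulVec]

theorem Matrix.PosSemidef.of_map_ofReal {m : Type*} [Fintype m] {A : Matrix m m ℝ}
    (hA : (A.map Complex.ofReal).PosSemidef) : A.PosSemidef := by
  refine .of_dotProduct_mulVec_nonneg ?_ fun x => ?_
  · ext i j
    have h := congrFun (congrFun hA.1 i) j
    simpa using h
  · have h := hA.dotProduct_mulVec_nonneg fun i => (x i : ℂ)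
    rw [A.ofReal_dotProduct_mulVec] at h
    exact_mod_cast h

theorem VC_add_smul_OmegaC {n : ℕ} (hbar : ℝ) (A B C : Matrix (Fin n) (Fin n) ℝ) :
    VC A C B + (Complex.I / 2) • OmegaC hbar n =
      fromBlocks (A.map Complex.ofReal) (C.map Complex.ofReal + (Complex.I * hbar / 2) • 1)
        (C.map Complex.ofReal + (Complex.I * hbar / 2) • 1)ᴴ (B.map Complex.ofReal) := by
  ext (i | i) (j | j) <;> by_cases hij : i = j <;>
    simp [VC, OmegaC, hij] <;> ring

theorem conjTranspose_map_ofReal_add {n : ℕ} (hbar : ℝ) (C : Matrix (Fin n) (Fin n) ℝ) :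
    (C.map Complex.ofReal + (Complex.I * hbar / 2) • 1)ᴴ =
      Cᵀ.map Complex.ofReal - (Complex.I * hbar / 2) • 1 := by
  ext i j
  by_cases hij : i = j <;> simp [hij, eq_comm (a := j)] <;> ring

/-- If `V + (i/2)Ω` is positive semidefinite then `A` is nonsingular: a real kernel vector `x` of
`A` gives the kernel vector `(x, 0)` of `V + (i/2)Ω`, and the imaginary part of its second
component is `-(hbar/2)x`. -/
theorem posDef_of_posSemidef_VC_add {n : ℕ} {hbar : ℝ} (hhbar : hbar ≠ 0)
    {A B C : Matrix (Fin n) (Fin n) ℝ}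
    (h : (VC A C B + (Complex.I / 2) • OmegaC hbar n).PosSemidef) : A.PosDef := by
  rw [VC_add_smul_OmegaC, conjTranspose_map_ofReal_add] at h
  have hA : A.PosSemidef := .of_map_ofReal (h.submatrix Sum.inl)
  refine hA.posDef_iff_isUnit.mpr (mulVec_injective_iff_isUnit.mp ?_)
  refine (injective_iff_map_eq_zero A.mulVecLin).mpr fun x hx => ?_
  replace hx : A *ᵥ x = 0 := hx
  have hker := (h.dotProduct_mulVec_zero_iff (Sum.elim (fun i => (x i : ℂ)) 0)).mp (by
    have h0 := A.ofReal_dotProduct_mulVec x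
    rw [hx, dotProduct_zero] at h0
    simpa [fromBlocks_mulVec, dotProduct, Fintype.sum_sum_type] using h0)
  ext i
  have hi := congrArg Complex.im (congrFun hker (Sum.inr i))
  simpa [fromBlocks_mulVec, sub_mulVec, smul_mulVec, mulVec, dotProduct, Matrix.one_apply,
    apply_ite Complex.im, hhbar] using hi

theorem posSemidef_VC_add_iff {n : ℕ} (hbar : ℝ) {A B C : Matrix (Fin n) (Fin n) ℝ}
    (hA : A.PosDef) :
    (VC A C B + (Complex.I / 2) • OmegaC hbar n).PosSemidef ↔
      (B.map Complex.ofReal -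
        (Cᵀ.map Complex.ofReal - (Complex.I * hbar / 2) • 1) * (A⁻¹).map Complex.ofReal *
          (C.map Complex.ofReal + (Complex.I * hbar / 2) • 1)).PosSemidef := by
  have := hA.map_ofReal.isUnit.invertible
  rw [VC_add_smul_OmegaC, PosDef.fromBlocks₁₁ _ _ hA.map_ofReal, conjTranspose_map_ofReal_add,
    map_ofReal_nonsing_inv hA.isUnit]

/-- `V + (i/2)Ω` is positive semidefinite iff `A` is positive definite and
the complex Hermitian matrix `B − (Cᵀ − (i·hbar/2)·I)·A⁻¹·(C + (i·hbar/2)·I)` is positive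
semidefinite. -/
theorem stmt_4 {n : ℕ} (hbar : ℝ) (hhbar : 0 < hbar)
    (A B C : Matrix (Fin n) (Fin n) ℝ) (hA : A.IsSymm) (hB : B.IsSymm) :
    (VC A C B + (Complex.I / 2) • OmegaC hbar n).PosSemidef ↔
      A.PosDef ∧
        (B.map Complex.ofReal -
          (Cᵀ.map Complex.ofReal - (Complex.I * hbar / 2) • 1) * (A⁻¹).map Complex.ofReal *
            (C.map Complex.ofReal + (Complex.I * hbar / 2) • 1)).PosSemidef := by
  constructor
  · intro h
    have hA' := posDef_of_posSemidef_VC_add hhbar.ne' h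
    exact ⟨hA', (posSemidef_VC_add_iff hbar hA').mp h⟩
  · rintro ⟨hA', h⟩
    exact (posSemidef_VC_add_iff hbar hA').mpr h
end

section
/- Let ħ > 0 and let V = [[A, C], [Cᵀ, B]] be a real symmetric 2n×2n block matrix such that the complex matrix V + (i/2)Ω is positive semidefinite, where Ω = [[0, ħ·I], [−ħ·I, 0]]. Then the real symmetric matrices B − Cᵀ·A⁻¹·C − (ħ²/4)·A⁻¹ and B − (ħ²/4)·A⁻¹ are positive semidefinite (in particular A is positive definite so A⁻¹ makes sense, and B is positive definite). -/
open Matrix ComplexOrder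

/-- The real quadratic inequality obtained by testing `V + (i/2)Ω` on `(p + i q, r)`. -/
lemma quadratic_form_nonneg {n : ℕ} {hbar : ℝ} {A B C : Matrix (Fin n) (Fin n) ℝ}
    (hpos : (VC A C B + (Complex.I / 2) • OmegaC hbar n).PosSemidef) (p q r : Fin n → ℝ) :
    0 ≤ p ⬝ᵥ A *ᵥ p + q ⬝ᵥ A *ᵥ q + 2 * (p ⬝ᵥ C *ᵥ r) + hbar * (q ⬝ᵥ r) + r ⬝ᵥ B *ᵥ r := by
  let c : (Fin n → ℝ) → Fin n → ℂ := fun v i ↦ (v i : ℂ)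
  have hdot (v w : Fin n → ℝ) : c v ⬝ᵥ c w = ((v ⬝ᵥ w : ℝ) : ℂ) :=
    (RingHom.map_dotProduct Complex.ofRealHom v w).symm
  have hmul (M : Matrix (Fin n) (Fin n) ℝ) (v : Fin n → ℝ) :
      M.map Complex.ofReal *ᵥ c v = c (M *ᵥ v) :=
    funext fun i ↦ (RingHom.map_mulVec Complex.ofRealHom M v i).symm
  have hstar (v : Fin n → ℝ) : star (c v) = c v := by ext i; simp [c]
  have h := (Complex.le_def.1
    (hpos.dotProduct_mulVec_nonneg (Sum.elim (c p + Complex.I • c q) (c r)))).1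
  have hs : star (Sum.elim (c p + Complex.I • c q) (c r)) =
      Sum.elim (c p - Complex.I • c q) (c r) := by
    ext (i | i) <;> simp [c, sub_eq_add_neg]
  rw [hs, VC, OmegaC, fromBlocks_map, fromBlocks_smul, fromBlocks_add, fromBlocks_mulVec,
    sumElim_dotProduct_sumElim, Sum.elim_comp_inl, Sum.elim_comp_inr] at h
  simp only [smul_zero, add_zero, add_mulVec, mulVec_add, mulVec_smul, smul_mulVec, neg_mulVec,
    smul_neg, one_mulVec, hmul, dotProduct_add, sub_dotProduct, dotProduct_smul, smul_dotProduct,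
    dotProduct_neg, hdot, smul_eq_mul, dotProduct_transpose_mulVec, dotProduct_comm r q] at h
  simp at h
  linarith

/-- If `V + (i/2)Ω` is positive semidefinite, then `A` and `B` are positive
definite and the real symmetric matrices `B − CᵀA⁻¹C − (hbar²/4)A⁻¹` and `B − (hbar²/4)A⁻¹`
are positive semidefinite. -/
theorem stmt_5 {n : ℕ} (hbar : ℝ) (hhbar : 0 < hbar)
    (A B C : Matrix (Fin n) (Fin n) ℝ) (hA : A.IsSymm) (hB : B.IsSymm)
    (hpos : (VC A C B + (Complex.I / 2) • OmegaC hbar n).PosSemidef) :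
    A.PosDef ∧ B.PosDef ∧
      (B - Cᵀ * A⁻¹ * C - (hbar ^ 2 / 4) • A⁻¹).PosSemidef ∧
      (B - (hbar ^ 2 / 4) • A⁻¹).PosSemidef := by
  have key := quadratic_form_nonneg hpos
  have hApos : A.PosDef := by
    refine .of_dotProduct_mulVec_pos hA fun x hx ↦ ?_
    have hxx : 0 < x ⬝ᵥ x := by simpa using dotProduct_star_self_pos_iff.2 hx
    by_contra! hneg
    rw [star_trivial] at hneg
    have h0 := key 0 0 x
    set t := -(x ⬝ᵥ B *ᵥ x + 1) / (hbar * (x ⬝ᵥ x)) with ht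
    have h1 := key 0 (t • x) x
    have h2 : hbar * (t * (x ⬝ᵥ x)) = -(x ⬝ᵥ B *ᵥ x + 1) := by
      rw [ht]; field_simp
    simp only [mulVec_smul, smul_dotProduct, dotProduct_smul, smul_eq_mul, zero_dotProduct, h2] at h1
    nlinarith [mul_nonneg (mul_self_nonneg t) (neg_nonneg.2 hneg)]
  have hAinv : A⁻¹.PosDef := hApos.inv
  have hAA : A * A⁻¹ = 1 := mul_nonsing_inv A (A.isUnit_iff_isUnit_det.1 hApos.isUnit)
  have hCinv : (Cᵀ * A⁻¹ * C).PosSemidef := by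
    simpa using hAinv.posSemidef.conjTranspose_mul_mul_same C
  have hschur : (B - Cᵀ * A⁻¹ * C - (hbar ^ 2 / 4) • A⁻¹).PosSemidef := by
    have hsmul : ((hbar ^ 2 / 4) • A⁻¹).IsHermitian := hAinv.isHermitian.smul (.all _)
    refine .of_dotProduct_mulVec_nonneg ((IsHermitian.sub hB hCinv.1).sub hsmul) fun r ↦ ?_
    have h := key (-(A⁻¹ *ᵥ C *ᵥ r)) (-(hbar / 2) • A⁻¹ *ᵥ r) r
    have hC : r ⬝ᵥ Cᵀ *ᵥ A⁻¹ *ᵥ C *ᵥ r = (A⁻¹ *ᵥ C *ᵥ r) ⬝ᵥ C *ᵥ r :=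
      dotProduct_transpose_mulVec ..
    simp only [mulVec_neg, mulVec_smul, neg_dotProduct, dotProduct_neg, smul_dotProduct,
      dotProduct_smul, smul_eq_mul, mulVec_mulVec, ← mul_assoc, hAA, one_mul, one_mulVec] at h
    simp only [star_trivial, sub_mulVec, smul_mulVec, dotProduct_sub, dotProduct_smul,
      smul_eq_mul, ← mulVec_mulVec, hC] at h ⊢
    rw [dotProduct_comm _ r] at h
    linarith
  have hsub : (B - (hbar ^ 2 / 4) • A⁻¹).PosSemidef := by
    convert hschur.add hCinv using 1
    abel
  refine ⟨hApos, ?_, hschur, hsub⟩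
  have hc : 0 < hbar ^ 2 / 4 := by positivity
  simpa using PosDef.posSemidef_add hsub (hAinv.smul hc)
end

section
/- Let ħ > 0 and let V = [[A, C], [Cᵀ, B]] be a real symmetric 2n×2n block matrix such that the complex matrix V + (i/2)Ω is positive semidefinite, where Ω = [[0, ħ·I], [−ħ·I, 0]]. Then (det A)·(det B) ≥ det V, det V = (det A)·det(B − CᵀA⁻¹C), and det V ≥ (ħ/2)^{2n}. -/
open Matrix ComplexOrder

section DetComparison

variable {𝕜 m : Type*} [RCLike 𝕜] [Fintype m] [DecidableEq m]

/-- A Hermitian matrix `M` with `-1 ≤ M ≤ 1` has determinant of norm at most one. -/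
lemma norm_det_le_one_of_posSemidef {M : Matrix m m 𝕜}
    (hadd : (1 + M).PosSemidef) (hsub : (1 - M).PosSemidef) : ‖M.det‖ ≤ 1 := by
  have hM : M.IsHermitian := by
    have := hadd.isHermitian.sub (isHermitian_one (n := m) (α := 𝕜))
    rwa [add_sub_cancel_left] at this
  rw [hM.det_eq_prod_eigenvalues, norm_prod]
  refine Finset.prod_le_one (fun _ _ => norm_nonneg _) fun i _ => ?_
  have hv := hM.mulVec_eigenvectorBasis i
  set v : m → 𝕜 := ⇑(hM.eigenvectorBasis i)
  have hunit : star v ⬝ᵥ v = 1 := by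
    have h := inner_self_eq_norm_sq_to_K (𝕜 := 𝕜) (hM.eigenvectorBasis i)
    rw [hM.eigenvectorBasis.orthonormal.1 i, EuclideanSpace.inner_eq_star_dotProduct,
      dotProduct_comm] at h
    simpa using h
  have h1 := hadd.re_dotProduct_nonneg v
  have h2 := hsub.re_dotProduct_nonneg v
  rw [add_mulVec, one_mulVec, hv, dotProduct_add, dotProduct_smul, hunit] at h1
  rw [sub_mulVec, one_mulVec, hv, dotProduct_sub, dotProduct_smul, hunit] at h2
  simp only [map_add, map_sub, RCLike.smul_re, RCLike.one_re, mul_one] at h1 h2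
  rw [RCLike.norm_ofReal, abs_le]
  constructor <;> linarith

/-- If `-P ≤ K ≤ P` with `P` positive definite, then `|det K| ≤ |det P|`. -/
lemma norm_det_le_norm_det_of_posSemidef {P K : Matrix m m 𝕜} (hP : P.PosDef)
    (hadd : (P + K).PosSemidef) (hsub : (P - K).PosSemidef) : ‖K.det‖ ≤ ‖P.det‖ := by
  obtain ⟨S, rfl⟩ : ∃ S : Matrix m m 𝕜, P = Sᴴ * S := by
    open scoped MatrixOrder in
    exact CStarAlgebra.nonneg_iff_eq_star_mul_self.mp hP.posSemidef.nonneg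
  have hS : IsUnit S.det := by
    have := hP.det_pos.ne'
    rw [det_mul] at this
    exact (right_ne_zero_of_mul this).isUnit
  have hinv : (S⁻¹)ᴴ * (Sᴴ * S) * S⁻¹ = 1 := by
    rw [Matrix.mul_assoc, Matrix.mul_assoc, mul_nonsing_inv _ hS, Matrix.mul_one,
      ← conjTranspose_mul, mul_nonsing_inv _ hS, conjTranspose_one]
  have h1 := hadd.conjTranspose_mul_mul_same S⁻¹
  have h2 := hsub.conjTranspose_mul_mul_same S⁻¹
  rw [Matrix.mul_add, Matrix.add_mul, hinv] at h1
  rw [Matrix.mul_sub, Matrix.sub_mul, hinv] at h2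
  have hle := norm_det_le_one_of_posSemidef h1 h2
  have hdet : K.det = (Sᴴ * S).det * ((S⁻¹)ᴴ * K * S⁻¹).det := by
    have h := congrArg det hinv
    simp only [det_mul, det_one] at h ⊢
    linear_combination (-K.det) * h
  rw [hdet, norm_mul]
  exact mul_le_of_le_one_right (norm_nonneg _) hle

/-- If `-P ≤ K ≤ P` with `K` nonsingular, then `P` is positive definite. -/
lemma posDef_of_posSemidef_add_sub {P K : Matrix m m 𝕜} (hK : K.det ≠ 0)
    (hadd : (P + K).PosSemidef) (hsub : (P - K).PosSemidef) : P.PosDef := by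
  have hP : P.PosSemidef := by
    have h := (hadd.add hsub).smul (show (0 : ℝ) ≤ 1 / 2 by norm_num)
    convert h using 1
    rw [add_add_sub_cancel, ← two_smul ℝ P, smul_smul]
    norm_num
  rw [hP.posDef_iff_det_ne_zero]
  intro h0
  obtain ⟨v, hv, hPv⟩ := exists_mulVec_eq_zero_iff.mpr h0
  have h1 := hadd.dotProduct_mulVec_nonneg v
  have h2 := hsub.dotProduct_mulVec_nonneg v
  rw [add_mulVec, hPv, zero_add] at h1
  rw [sub_mulVec, hPv, zero_sub, dotProduct_neg, neg_nonneg] at h2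
  have h3 := (hadd.dotProduct_mulVec_zero_iff v).mp (by
    rw [add_mulVec, hPv, zero_add]
    exact le_antisymm h2 h1)
  rw [add_mulVec, hPv, zero_add] at h3
  exact hK (exists_mulVec_eq_zero_iff.mp ⟨v, hv, h3⟩)

end DetComparison

/-- A real matrix which is positive definite as a complex matrix is positive definite. -/
lemma posDef_of_posDef_map_ofReal {m : Type*} [Fintype m] {M : Matrix m m ℝ}
    (hM : (M.map Complex.ofReal).PosDef) : M.PosDef := by
  refine .of_dotProduct_mulVec_pos ?_ fun x hx => ?_
  · ext i j
    have h := congrFun (congrFun hM.isHermitian i) j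
    simpa using h
  · have hne : (fun i => (x i : ℂ)) ≠ 0 := fun h => hx <| by
      ext i
      simpa using congrFun h i
    have h := hM.dotProduct_mulVec_pos hne
    have hcast : star (fun i => (x i : ℂ)) ⬝ᵥ (M.map Complex.ofReal *ᵥ fun i => (x i : ℂ))
        = ((star x ⬝ᵥ (M *ᵥ x) : ℝ) : ℂ) := by
      simp [dotProduct, mulVec]
    rw [hcast] at h
    exact_mod_cast h

lemma norm_det_I_div_two_smul_OmegaC (hbar : ℝ) (hhbar : 0 < hbar) (n : ℕ) :
    ‖((Complex.I / 2) • OmegaC hbar n).det‖ = (hbar / 2) ^ (2 * n) := by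
  have hsq : ((Complex.I / 2) • OmegaC hbar n) * ((Complex.I / 2) • OmegaC hbar n)
      = (((hbar / 2 : ℝ) : ℂ) ^ 2) • 1 := by
    rw [OmegaC, smul_mul_smul_comm, fromBlocks_multiply, ← fromBlocks_one, fromBlocks_smul,
      fromBlocks_smul]
    have hI : Complex.I ^ 2 = -1 := Complex.I_sq
    have hscalar : Complex.I / 2 * (Complex.I / 2) * -((hbar : ℂ) * hbar)
        = ((hbar / 2 : ℝ) : ℂ) ^ 2 := by
      push_cast
      linear_combination (-(hbar : ℂ) ^ 2 / 4) * hI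
    rw [← hscalar]
    congr 1
    · simp only [Matrix.zero_mul, zero_add, smul_mul_smul_comm, Matrix.mul_one,
        ← neg_smul, smul_smul, mul_neg]
    · simp
    · simp
    · simp only [Matrix.mul_zero, add_zero, smul_mul_smul_comm, Matrix.mul_one,
        ← neg_smul, smul_smul, mul_neg, neg_mul]
  have h := congrArg (fun M => ‖M.det‖) hsq
  simp only [det_mul, det_smul, det_one, norm_mul, norm_pow, mul_one,
    Fintype.card_sum, Fintype.card_fin, Complex.norm_real, Real.norm_eq_abs,
    abs_of_pos (half_pos hhbar)] at h ⊢
  refine (sq_eq_sq₀ (by positivity) (by positivity)).mp ?_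
  rw [sq, h, ← pow_mul, ← pow_mul]
  congr 1
  ring

/-- If `V + (i/2)Ω` is positive semidefinite, then
`(det A)(det B) ≥ det V`, `det V = (det A)·det(B − CᵀA⁻¹C)`, and `det V ≥ (hbar/2)^(2n)`. -/
theorem stmt_6 {n : ℕ} (hbar : ℝ) (hhbar : 0 < hbar)
    (A B C : Matrix (Fin n) (Fin n) ℝ) (hA : A.IsSymm) (hB : B.IsSymm)
    (hpos : (VC A C B + (Complex.I / 2) • OmegaC hbar n).PosSemidef) :
    (Matrix.fromBlocks A C Cᵀ B).det ≤ A.det * B.det ∧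
      (Matrix.fromBlocks A C Cᵀ B).det = A.det * (B - Cᵀ * A⁻¹ * C).det ∧
      (hbar / 2) ^ (2 * n) ≤ (Matrix.fromBlocks A C Cᵀ B).det := by
  set K := (Complex.I / 2) • OmegaC hbar n with hK
  have hnorm : ‖K.det‖ = (hbar / 2) ^ (2 * n) := norm_det_I_div_two_smul_OmegaC hbar hhbar n
  have hKdet : K.det ≠ 0 := norm_ne_zero_iff.mp (by rw [hnorm]; positivity)
  have hsub : (VC A C B - K).PosSemidef := by
    have hV : (VC A C B)ᵀ = VC A C B := by
      rw [VC, ← transpose_map, fromBlocks_transpose, hA.eq, hB.eq, transpose_transpose]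
    have hKT : Kᵀ = -K := by
      rw [hK, OmegaC, transpose_smul, fromBlocks_transpose, ← smul_neg (Complex.I / 2), fromBlocks_neg]
      simp
    have h := hpos.transpose
    rwa [transpose_add, hV, hKT, ← sub_eq_add_neg] at h
  have hVC : (VC A C B).PosDef := posDef_of_posSemidef_add_sub hKdet hpos hsub
  have hV : (fromBlocks A C Cᵀ B).PosDef := posDef_of_posDef_map_ofReal hVC
  have hAp : A.PosDef := hV.submatrix (e := Sum.inl) Sum.inl_injective
  have hBp : B.PosDef := hV.submatrix (e := Sum.inr) Sum.inr_injective
  let _ : Invertible A := hAp.isUnit.invertible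
  have hdet : (fromBlocks A C Cᵀ B).det = A.det * (B - Cᵀ * A⁻¹ * C).det := by
    rw [det_fromBlocks₁₁, invOf_eq_nonsing_inv]
  refine ⟨?_, hdet, ?_⟩
  · have hS : (B - Cᵀ * A⁻¹ * C).PosSemidef := by
      have h := (PosDef.fromBlocks₁₁ C B hAp).mp (by
        rw [conjTranspose_eq_transpose_of_trivial]
        exact hV.posSemidef)
      rwa [conjTranspose_eq_transpose_of_trivial] at h
    have hR : (B - (B - Cᵀ * A⁻¹ * C)).PosSemidef := by
      rw [sub_sub_cancel, ← conjTranspose_eq_transpose_of_trivial C]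
      exact hAp.posSemidef.inv.conjTranspose_mul_mul_same C
    have hle := norm_det_le_norm_det_of_posSemidef hBp (hBp.posSemidef.add hS) hR
    rw [Real.norm_of_nonneg hS.det_nonneg, Real.norm_of_nonneg hBp.det_pos.le] at hle
    rw [hdet]
    exact mul_le_mul_of_nonneg_left hle hAp.det_pos.le
  · have hle := norm_det_le_norm_det_of_posSemidef hVC hpos hsub
    have hcast : (VC A C B).det = ((fromBlocks A C Cᵀ B).det : ℂ) :=
      (RingHom.map_det Complex.ofRealHom _).symm
    rwa [hnorm, hcast, Complex.norm_real, Real.norm_of_nonneg hV.det_pos.le] at hle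
end

section
/- Let ħ > 0 and let V = [[A, C], [Cᵀ, B]] be a real symmetric 2n×2n block matrix such that the complex matrix V + (i/2)Ω is positive semidefinite, where Ω = [[0, ħ·I], [−ħ·I, 0]]. Then det V = (ħ/2)^{2n} if and only if B = CᵀA⁻¹C + (ħ²/4)A⁻¹; moreover, in that case C·A = A·Cᵀ. -/
open Matrix ComplexOrder

open scoped MatrixOrder Matrix.Norms.L2Operator

/-- If `E` is positive semidefinite and `det (1 + E) = 1`, then `E = 0`. -/
lemma Matrix.PosSemidef.eq_zero_of_det_one_add_eq_one {m : Type*} [Fintype m] [DecidableEq m]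
    {E : Matrix m m ℂ} (hE : E.PosSemidef) (h : (1 + E).det = 1) : E = 0 := by
  have hdet : (1 + E).det = ∏ i, (1 + (hE.1.eigenvalues i : ℂ)) := by
    conv_lhs => rw [hE.1.spectral_theorem, ← map_one (Unitary.conjStarAlgAut ℂ _ _), ← map_add,
      Unitary.conjStarAlgAut_apply, det_mul_right_comm,
      Unitary.mul_star_self_of_mem hE.1.eigenvectorUnitary.2, one_mul, ← diagonal_one, diagonal_add, det_diagonal]
    rfl
  have hprod : ∏ i, (1 + hE.1.eigenvalues i) = 1 := by
    rw [hdet] at h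
    exact_mod_cast h
  have hle : ∀ i, 1 ≤ 1 + hE.1.eigenvalues i := fun i => by linarith [hE.eigenvalues_nonneg i]
  rw [← hE.isHermitian.eigenvalues_eq_zero_iff]
  funext i
  have h₁ := Finset.mul_prod_erase Finset.univ (fun i => 1 + hE.1.eigenvalues i) (Finset.mem_univ i)
  have h₂ : 1 ≤ ∏ j ∈ Finset.univ.erase i, (1 + hE.1.eigenvalues j) :=
    Finset.one_le_prod fun j _ => hle j
  simp only [hprod] at h₁
  have := hE.eigenvalues_nonneg i
  show _ = (0 : ℝ)
  nlinarith

/-- Adding a nonzero positive semidefinite matrix to a positive definite one changes its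
determinant. -/
lemma Matrix.PosSemidef.eq_zero_of_det_add_eq {m : Type*} [Fintype m] [DecidableEq m]
    {D P : Matrix m m ℂ} (hD : D.PosSemidef) (hP : P.PosDef) (h : (D + P).det = P.det) :
    D = 0 := by
  obtain ⟨Y, rfl⟩ := CStarAlgebra.nonneg_iff_eq_star_mul_self.mp hP.posSemidef.nonneg
  have hdet := hP.det_pos.ne'
  rw [star_eq_conjTranspose] at *
  have hY : IsUnit Y.det := by
    rw [isUnit_iff_ne_zero]
    rintro h0
    exact hdet (by rw [det_mul, h0, mul_zero])
  have hY' : IsUnit Yᴴ.det := by rw [det_conjTranspose]; exact hY.star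
  set E := (Y⁻¹)ᴴ * D * Y⁻¹ with hEdef
  have hDE : D = Yᴴ * E * Y := by
    rw [hEdef, conjTranspose_nonsing_inv]
    simp only [Matrix.mul_assoc, nonsing_inv_mul _ hY, Matrix.mul_one]
    rw [mul_nonsing_inv_cancel_left _ _ hY']
  have hE : E = 0 := by
    refine (hD.conjTranspose_mul_mul_same _).eq_zero_of_det_one_add_eq_one ?_
    have : D + Yᴴ * Y = Yᴴ * (1 + E) * Y := by
      rw [Matrix.mul_add, Matrix.add_mul, ← hDE, Matrix.mul_one, add_comm]
    rw [this, det_mul, det_mul, det_mul] at h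
    rw [det_mul] at hdet
    refine mul_left_cancel₀ hdet ?_
    rw [mul_one]
    linear_combination h
  rw [hDE, hE, Matrix.mul_zero, Matrix.zero_mul]

/-- The determinant commutes with the embedding of real matrices into complex ones. -/
lemma Matrix.det_map_complex_ofReal {m : Type*} [Fintype m] [DecidableEq m] (X : Matrix m m ℝ) :
    (X.map Complex.ofReal).det = X.det :=
  (Complex.ofRealHom.map_det X).symm

/-- Inversion commutes with the embedding of real matrices into complex ones. -/
lemma Matrix.inv_map_complex_ofReal {m : Type*} [Fintype m] [DecidableEq m] {X : Matrix m m ℝ}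
    (hX : IsUnit X.det) : (X.map Complex.ofReal)⁻¹ = X⁻¹.map Complex.ofReal := by
  apply inv_eq_left_inv
  have h := congrArg Complex.ofRealHom.mapMatrix (nonsing_inv_mul X hX)
  rwa [map_mul, map_one] at h

/-- The top-left block of a covariance matrix satisfying the uncertainty principle is positive
definite. -/
lemma posDef_of_uncertainty {n : ℕ} {hbar : ℝ} (hhbar : 0 < hbar)
    {A B C : Matrix (Fin n) (Fin n) ℝ}
    (hpos : (VC A C B + (Complex.I / 2) • OmegaC hbar n).PosSemidef) :
    (A.map Complex.ofReal).PosDef := by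
  have hAps : (A.map Complex.ofReal).PosSemidef := by
    convert hpos.submatrix Sum.inl using 1
    ext i j
    simp [VC, OmegaC]
  rw [hAps.posDef_iff_det_ne_zero]
  intro h0
  have h0' : A.det = 0 := by
    rw [det_map_complex_ofReal] at h0
    exact_mod_cast h0
  obtain ⟨x, hx, hAx⟩ := exists_mulVec_eq_zero_iff.mpr h0'
  have hax : A.map Complex.ofReal *ᵥ (fun i => (x i : ℂ)) = 0 := by
    funext i
    have := congrFun hAx i
    simp only [mulVec, dotProduct, map_apply, Pi.zero_apply] at this ⊢
    exact_mod_cast this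
  have hv : (VC A C B + (Complex.I / 2) • OmegaC hbar n) *ᵥ
      Sum.elim (fun i => (x i : ℂ)) 0 = 0 := by
    rw [← hpos.dotProduct_mulVec_zero_iff, VC, OmegaC, fromBlocks_map, fromBlocks_smul,
      fromBlocks_add, fromBlocks_mulVec]
    simp [dotProduct, Fintype.sum_sum_type, hax]
  refine hx (funext fun i => ?_)
  have := congrArg Complex.im (congrFun hv (Sum.inr i))
  rw [VC, OmegaC, fromBlocks_map, fromBlocks_smul, fromBlocks_add, fromBlocks_mulVec] at this
  simp [mulVec, dotProduct, add_mul, Finset.sum_add_distrib, Matrix.one_apply, hhbar.ne'] at this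
  exact this

/-- The Schur complement form of the uncertainty principle. -/
lemma schur_of_uncertainty {n : ℕ} {hbar : ℝ} (hhbar : 0 < hbar)
    {A B C : Matrix (Fin n) (Fin n) ℝ}
    (hpos : (VC A C B + (Complex.I / 2) • OmegaC hbar n).PosSemidef) :
    ((B - Cᵀ * A⁻¹ * C - (hbar ^ 2 / 4) • A⁻¹).map Complex.ofReal +
      (Complex.I * hbar / 2) • (A⁻¹ * C - Cᵀ * A⁻¹).map Complex.ofReal).PosSemidef := by
  have hA := posDef_of_uncertainty hhbar hpos
  have := hA.isUnit.invertible
  have hu : IsUnit A.det := by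
    have h := hA.det_pos.ne'
    rw [det_map_complex_ofReal] at h
    exact isUnit_iff_ne_zero.mpr (mod_cast h)
  have hM : VC A C B + (Complex.I / 2) • OmegaC hbar n =
      fromBlocks (A.map Complex.ofReal) (C.map Complex.ofReal + (Complex.I * hbar / 2) • 1)
        (C.map Complex.ofReal + (Complex.I * hbar / 2) • 1)ᴴ (B.map Complex.ofReal) := by
    rw [VC, OmegaC, fromBlocks_map, fromBlocks_smul, fromBlocks_add]
    congr 1
    · simp
    · rw [smul_smul]; congr 2; ring
    · ext i j
      by_cases h : i = j
      · simp [h]; ring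
      · simp [h, Ne.symm h]
    · simp
  rw [hM, PosDef.fromBlocks₁₁ _ _ hA, inv_map_complex_ofReal hu] at hpos
  refine Eq.subst (motive := Matrix.PosSemidef) ?_ hpos
  have hC : (C.map Complex.ofReal)ᴴ = Cᵀ.map Complex.ofReal := by ext i j; simp
  have hmul (X Y : Matrix (Fin n) (Fin n) ℝ) : (X * Y).map Complex.ofReal =
      X.map Complex.ofReal * Y.map Complex.ofReal := map_mul Complex.ofRealHom.mapMatrix X Y
  have hsub (X Y : Matrix (Fin n) (Fin n) ℝ) : (X - Y).map Complex.ofReal =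
      X.map Complex.ofReal - Y.map Complex.ofReal := map_sub Complex.ofRealHom.mapMatrix X Y
  have hsmul (r : ℝ) (X : Matrix (Fin n) (Fin n) ℝ) : (r • X).map Complex.ofReal =
      (r : ℂ) • X.map Complex.ofReal := by ext i j; simp
  rw [conjTranspose_add, conjTranspose_smul, conjTranspose_one, hC]
  have hs : star (Complex.I * hbar / 2) = -(Complex.I * hbar / 2) := by simp; ring
  have hk : ((hbar ^ 2 / 4 : ℝ) : ℂ) = -((Complex.I * hbar / 2) * (Complex.I * hbar / 2)) := by
    push_cast
    linear_combination ((hbar : ℂ) ^ 2 / 4) * Complex.I_sq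
  simp only [hs, hsub, hsmul, hmul, hk, Matrix.add_mul, Matrix.mul_add, smul_mul_assoc,
    mul_smul_comm, one_mul, mul_one]
  module

/-- If `V + (i/2)Ω` is positive semidefinite, then
`det V = (hbar/2)^(2n)` iff `B = CᵀA⁻¹C + (hbar²/4)A⁻¹`; moreover in that case `CA = ACᵀ`. -/
theorem stmt_7 {n : ℕ} (hbar : ℝ) (hhbar : 0 < hbar)
    (A B C : Matrix (Fin n) (Fin n) ℝ) (hA : A.IsSymm) (hB : B.IsSymm)
    (hpos : (VC A C B + (Complex.I / 2) • OmegaC hbar n).PosSemidef) :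
    ((Matrix.fromBlocks A C Cᵀ B).det = (hbar / 2) ^ (2 * n) ↔
        B = Cᵀ * A⁻¹ * C + (hbar ^ 2 / 4) • A⁻¹) ∧
      ((Matrix.fromBlocks A C Cᵀ B).det = (hbar / 2) ^ (2 * n) → C * A = A * Cᵀ) := by
  have hApos := posDef_of_uncertainty hhbar hpos
  have hM := schur_of_uncertainty hhbar hpos
  have hA0 : A.det ≠ 0 := by
    have h := hApos.det_pos.ne'
    rw [det_map_complex_ofReal] at h
    exact_mod_cast h
  have hu : IsUnit A.det := isUnit_iff_ne_zero.mpr hA0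
  have := A.invertibleOfIsUnitDet hu
  set D := B - Cᵀ * A⁻¹ * C - (hbar ^ 2 / 4) • A⁻¹ with hD
  have hAinv : A⁻¹ᵀ = A⁻¹ := by rw [transpose_nonsing_inv, hA.eq]
  have hDt : Dᵀ = D := by
    simp [hD, transpose_sub, transpose_mul, hB.eq, hAinv, Matrix.mul_assoc]
  have hBD : B = Cᵀ * A⁻¹ * C + (hbar ^ 2 / 4) • A⁻¹ ↔ D = 0 := by
    rw [hD, sub_sub, sub_eq_zero]
  have hdet : (fromBlocks A C Cᵀ B).det = A.det * (D + (hbar ^ 2 / 4) • A⁻¹).det := by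
    rw [det_fromBlocks₁₁, hD, sub_add_cancel, invOf_eq_nonsing_inv]
  have hdet₀ : A.det * ((hbar ^ 2 / 4) • A⁻¹).det = (hbar / 2) ^ (2 * n) := by
    rw [det_smul, Fintype.card_fin, det_nonsing_inv, Ring.inverse_eq_inv', pow_mul, mul_left_comm,
      mul_inv_cancel₀ hA0, mul_one]
    ring
  have hD0 : (fromBlocks A C Cᵀ B).det = (hbar / 2) ^ (2 * n) ↔ D = 0 := by
    refine ⟨fun h => ?_, fun h => by rw [hdet, h, zero_add, hdet₀]⟩
    rw [hdet, ← hdet₀] at h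
    have h := mul_left_cancel₀ hA0 h
    have hDps : ((2 : ℝ) • D.map Complex.ofReal).PosSemidef := by
      convert hM.add hM.transpose using 1
      ext i j
      have h₁ := congrFun (congrFun hDt i) j
      have h₂ : (A⁻¹ * C - Cᵀ * A⁻¹)ᵀ = -(A⁻¹ * C - Cᵀ * A⁻¹) := by
        simp [transpose_sub, transpose_mul, hAinv]
      have h₂ := congrFun (congrFun h₂ i) j
      simp only [transpose_apply, Matrix.neg_apply] at h₁ h₂
      simp only [Matrix.smul_apply, Matrix.add_apply, map_apply, transpose_apply, h₁, h₂]
      simp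
      ring
    have hDps' : (D.map Complex.ofReal).PosSemidef := by
      have := hDps.smul (show (0 : ℝ) ≤ 1 / 2 by norm_num)
      rw [smul_smul] at this
      norm_num at this
      exact this
    have hPd : (((hbar ^ 2 / 4) • A⁻¹).map Complex.ofReal).PosDef := by
      have := hApos.inv.smul (show (0 : ℝ) < hbar ^ 2 / 4 by positivity)
      refine Eq.subst (motive := Matrix.PosDef) ?_ this
      rw [inv_map_complex_ofReal hu]
      ext i j
      simp
    have := hDps'.eq_zero_of_det_add_eq hPd (by
      rw [det_map_complex_ofReal, ← h, ← det_map_complex_ofReal]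
      congr 1
      ext i j
      simp)
    ext i j
    simpa using congrFun (congrFun this i) j
  refine ⟨hD0.trans hBD.symm, fun h => ?_⟩
  rw [hD0.mp h] at hM
  have hzero := hM.trace_eq_zero_iff.mp (by
    have : (A⁻¹ * C - Cᵀ * A⁻¹).trace = 0 := by
      rw [trace_sub, ← trace_transpose (A⁻¹ * C), transpose_mul, hAinv, sub_self]
    rw [trace_add, trace_smul]
    have h' : ((A⁻¹ * C - Cᵀ * A⁻¹).map Complex.ofReal).trace = 0 := by
      simp only [trace, diag, map_apply] at this ⊢
      exact_mod_cast this
    rw [h']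
    simp [trace])
  have hK : A⁻¹ * C = Cᵀ * A⁻¹ := by
    ext i j
    have := congrFun (congrFun hzero i) j
    simp [hhbar.ne', sub_eq_zero] at this
    exact_mod_cast this
  calc C * A = A * (A⁻¹ * C) * A := by rw [mul_nonsing_inv_cancel_left _ _ hu]
    _ = A * Cᵀ := by rw [hK, Matrix.mul_assoc, nonsing_inv_mul_cancel_right _ _ hu]
end

section
/- Let ħ > 0, let u, v ∈ ℝⁿ be unit vectors, and let c_Q > 0, c_P > 0 be real numbers. Then there exists a real symmetric 2n×2n block matrix V = [[A, C], [Cᵀ, B]] such that the complex matrix V + (i/2)Ω is positive semidefinite (where Ω = [[0, ħ·I], [−ħ·I, 0]]), uᵀAu = c_Q and vᵀBv = c_P, if and only if c_Q · c_P ≥ (ħ²/4)·(uᵀv)². -/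
open Matrix ComplexOrder

/-- If `M * Nᵀ = 1`, then `(hbar/2) • [[M Mᵀ, 0], [0, N Nᵀ]]` satisfies the uncertainty
inequality. -/
lemma posSemidef_VC_of_mul_transpose_eq_one {n : ℕ} {m : Type*} [Fintype m] {hbar : ℝ}
    (hhbar : 0 ≤ hbar) (M N : Matrix (Fin n) m ℝ) (h : M * Nᵀ = 1) :
    (VC ((hbar / 2) • (M * Mᵀ)) 0 ((hbar / 2) • (N * Nᵀ)) +
      (Complex.I / 2) • OmegaC hbar n).PosSemidef := by
  have h' : N * Mᵀ = 1 := by simpa using congrArg transpose h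
  set f : ℝ →+* ℂ := Complex.ofRealHom
  have hf : ∀ (X : Matrix (Fin n) m ℝ), (X.map f)ᴴ = Xᵀ.map f := by
    intro X; ext i j; simp [f]
  have hfmul : ∀ (X Y : Matrix (Fin n) m ℝ), X.map f * (Y.map f)ᴴ = (X * Yᵀ).map f := by
    intro X Y; rw [hf, Matrix.map_mul]
  have hZ := (posSemidef_self_mul_conjTranspose
    (fromRows (M.map f) ((-Complex.I) • N.map f))).smul (a := ((hbar / 2 : ℝ) : ℂ))
      (by exact_mod_cast (by positivity : 0 ≤ hbar / 2))
  convert hZ using 1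
  rw [conjTranspose_fromRows_eq_fromCols_conjTranspose, fromRows_mul_fromCols]
  simp only [conjTranspose_smul, Matrix.smul_mul, Matrix.mul_smul, hfmul, h, h']
  ext (i | i) (j | j)
  · simp [-Matrix.map_mul, VC, OmegaC, f]
  · by_cases hij : i = j <;> simp [-Matrix.map_mul, VC, OmegaC, f, hij, one_apply]; ring
  · by_cases hij : i = j <;> simp [-Matrix.map_mul, VC, OmegaC, f, hij, one_apply]; ring
  · simp [-Matrix.map_mul, VC, OmegaC, f, ← mul_assoc]

/-- A decomposition `1 = E Fᵀ + p₁ q₁ᵀ + p₂ q₂ᵀ` with `Eᵀ u = 0` and `Fᵀ v = 0` produces a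
covariance matrix with prescribed variances along `u` and `v`. -/
lemma exists_covariance_of_decomposition {n : ℕ} {hbar : ℝ} (hhbar : 0 ≤ hbar)
    {u v : Fin n → ℝ} {cQ cP : ℝ} (E F : Matrix (Fin n) (Fin n) ℝ) (p₁ q₁ p₂ q₂ : Fin n → ℝ)
    (h : E * Fᵀ + vecMulVec p₁ q₁ + vecMulVec p₂ q₂ = 1)
    (hE : Eᵀ *ᵥ u = 0) (hF : Fᵀ *ᵥ v = 0)
    (hQ : hbar / 2 * ((p₁ ⬝ᵥ u) ^ 2 + (p₂ ⬝ᵥ u) ^ 2) = cQ)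
    (hP : hbar / 2 * ((q₁ ⬝ᵥ v) ^ 2 + (q₂ ⬝ᵥ v) ^ 2) = cP) :
    ∃ A B C : Matrix (Fin n) (Fin n) ℝ, A.IsSymm ∧ B.IsSymm ∧
        (VC A C B + (Complex.I / 2) • OmegaC hbar n).PosSemidef ∧
        u ⬝ᵥ A *ᵥ u = cQ ∧ v ⬝ᵥ B *ᵥ v = cP := by
  have key : ∀ (X Y : Matrix (Fin n) (Fin n) ℝ) (a b c d : Fin n → ℝ),
      fromCols X (of ![a, b])ᵀ * (fromCols Y (of ![c, d])ᵀ)ᵀ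
        = X * Yᵀ + vecMulVec a c + vecMulVec b d := by
    intro X Y a b c d
    rw [transpose_fromCols, fromCols_mul_fromRows, add_assoc]
    congr 1
    ext i j
    simp [mul_apply, Fin.sum_univ_two, vecMulVec_apply]
  have quad : ∀ (X : Matrix (Fin n) (Fin n) ℝ) (a b w : Fin n → ℝ), Xᵀ *ᵥ w = 0 →
      w ⬝ᵥ ((hbar / 2) • (X * Xᵀ + vecMulVec a a + vecMulVec b b)) *ᵥ w
        = hbar / 2 * ((a ⬝ᵥ w) ^ 2 + (b ⬝ᵥ w) ^ 2) := by
    intro X a b w hw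
    simp [smul_mulVec, add_mulVec, ← mulVec_mulVec, hw, vecMulVec_mulVec, dotProduct_comm w]
    ring
  have hpsd := posSemidef_VC_of_mul_transpose_eq_one hhbar
    (fromCols E (of ![p₁, p₂])ᵀ) (fromCols F (of ![q₁, q₂])ᵀ) (by rw [key, h])
  rw [key, key] at hpsd
  refine ⟨_, _, 0, ?_, ?_, hpsd, ?_, ?_⟩
  · simp [IsSymm, transpose_vecMulVec]
  · simp [IsSymm, transpose_vecMulVec]
  · rw [quad _ _ _ _ hE, hQ]
  · rw [quad _ _ _ _ hF, hP]

/-- The uncertainty inequality evaluated at the vector `(a, i b)`. -/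
lemma covariance_quadratic_nonneg {n : ℕ} {hbar : ℝ} {A B C : Matrix (Fin n) (Fin n) ℝ}
    (h : (VC A C B + (Complex.I / 2) • OmegaC hbar n).PosSemidef) (a b : Fin n → ℝ) :
    0 ≤ a ⬝ᵥ A *ᵥ a + b ⬝ᵥ B *ᵥ b - hbar * (a ⬝ᵥ b) := by
  have h0 := (Complex.le_def.1 (h.dotProduct_mulVec_nonneg
    (Sum.elim (fun i => (a i : ℂ)) (fun i => Complex.I * (b i : ℂ))))).1
  refine h0.trans_eq ?_
  simp [dotProduct, mulVec, VC, OmegaC, add_mul, Finset.sum_add_distrib, Finset.mul_sum, one_apply]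
  rw [← Finset.sum_add_distrib, ← Finset.sum_add_distrib, ← Finset.sum_sub_distrib]
  refine Finset.sum_congr rfl fun x _ => ?_
  rw [← Finset.mul_sum, ← Finset.mul_sum]
  ring

/-- For unit vectors `u, v ∈ ℝⁿ` and positive reals `c_Q`, `c_P`, there is a
real symmetric block matrix `V = [[A, C], [Cᵀ, B]]` with `V + (i/2)Ω` positive semidefinite,
`uᵀAu = c_Q` and `vᵀBv = c_P`, iff `c_Q·c_P ≥ (hbar²/4)·(uᵀv)²`. -/
theorem stmt_10 {n : ℕ} (hbar : ℝ) (hhbar : 0 < hbar)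
    (u v : Fin n → ℝ) (hu : u ⬝ᵥ u = 1) (hv : v ⬝ᵥ v = 1)
    (cQ cP : ℝ) (hcQ : 0 < cQ) (hcP : 0 < cP) :
    (∃ A B C : Matrix (Fin n) (Fin n) ℝ, A.IsSymm ∧ B.IsSymm ∧
        (VC A C B + (Complex.I / 2) • OmegaC hbar n).PosSemidef ∧
        u ⬝ᵥ A *ᵥ u = cQ ∧ v ⬝ᵥ B *ᵥ v = cP) ↔
      hbar ^ 2 / 4 * (u ⬝ᵥ v) ^ 2 ≤ cQ * cP := by
  constructor
  · rintro ⟨A, B, C, -, -, h, hA, hB⟩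
    have h1 := covariance_quadratic_nonneg h ((hbar * (u ⬝ᵥ v)) • u) ((2 * cQ) • v)
    simp only [mulVec_smul, dotProduct_smul, smul_dotProduct, hA, hB, smul_eq_mul] at h1
    have h2 : 0 ≤ cQ * (4 * (cQ * cP) - hbar ^ 2 * (u ⬝ᵥ v) ^ 2) := by linarith
    have h3 := nonneg_of_mul_nonneg_right h2 hcQ
    linarith
  · intro h
    by_cases hk : u ⬝ᵥ v = 0
    · have hk' : v ⬝ᵥ u = 0 := by rw [dotProduct_comm, hk]
      obtain ⟨s, hs, hs2⟩ : ∃ s : ℝ, s ≠ 0 ∧ s ^ 2 = 2 * cQ / hbar :=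
        ⟨√(2 * cQ / hbar), by positivity, Real.sq_sqrt (by positivity)⟩
      obtain ⟨t, ht, ht2⟩ : ∃ t : ℝ, t ≠ 0 ∧ t ^ 2 = 2 * cP / hbar :=
        ⟨√(2 * cP / hbar), by positivity, Real.sq_sqrt (by positivity)⟩
      refine exists_covariance_of_decomposition hhbar.le
        (1 - vecMulVec u u - vecMulVec v v) (1 - vecMulVec u u - vecMulVec v v)
        (s • u) (s⁻¹ • u) (t⁻¹ • v) (t • v) ?_ ?_ ?_ ?_ ?_
      · simp [transpose_vecMulVec, sub_mul, mul_sub, vecMulVec_mul_vecMulVec, hu, hv, hk, hk',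
          vecMulVec_smul, smul_vecMulVec, smul_smul, hs, ht]
        abel
      · simp [transpose_vecMulVec, sub_mulVec, vecMulVec_mulVec, hu, hk']
      · simp [transpose_vecMulVec, sub_mulVec, vecMulVec_mulVec, hv, hk]
      · simp [hu, hk', hs2]; field_simp
      · simp [hv, hk, ht2]; field_simp
    · set k := u ⬝ᵥ v with hkdef
      have hk' : v ⬝ᵥ u = k := by rw [dotProduct_comm]
      obtain ⟨s, hs, hs2⟩ : ∃ s : ℝ, s ≠ 0 ∧ s ^ 2 = 2 * cQ / (hbar * k ^ 2) :=
        ⟨√(2 * cQ / (hbar * k ^ 2)), by positivity, Real.sq_sqrt (by positivity)⟩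
      have hslack : 0 ≤ 2 * cP / hbar - hbar * k ^ 2 / (2 * cQ) := by
        rw [sub_nonneg, div_le_div_iff₀ (by positivity) hhbar]
        linarith
      refine exists_covariance_of_decomposition hhbar.le
        (1 - k⁻¹ • vecMulVec v u) (1 - k⁻¹ • vecMulVec u v)
        (s • v) ((s * k)⁻¹ • u) 0 (√(2 * cP / hbar - hbar * k ^ 2 / (2 * cQ)) • v) ?_ ?_ ?_ ?_ ?_
      · simp [transpose_vecMulVec, sub_mul, mul_sub, vecMulVec_mul_vecMulVec, ← hkdef,
          vecMulVec_smul, smul_vecMulVec, smul_smul, hs, hk]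
      · simp [transpose_vecMulVec, sub_mulVec, smul_mulVec, vecMulVec_mulVec, hk', hk,
          smul_smul]
      · simp [transpose_vecMulVec, sub_mulVec, smul_mulVec, vecMulVec_mulVec, ← hkdef, hk,
          smul_smul]
      · simp [hk', mul_pow, hs2]; field_simp
      · simp [hv, ← hkdef, mul_pow, hs2, Real.sq_sqrt hslack]; field_simp; ring
end

section
/- Define s : ℝ → ℝ by s(x) = ln(1 + x) − x/(1 + x). Then for every z > 0 and every x > 0 one has s(x) + s(z²/x) ≥ 2·s(z), with equality if and only if x = z. -/
/-- The function `s(x) = ln(1 + x) − x/(1 + x)`. -/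
noncomputable def sFun (x : ℝ) : ℝ := Real.log (1 + x) - x / (1 + x)

theorem sFun_eq_log_add_inv {x : ℝ} (hx : 0 < x) :
    sFun x = Real.log (1 + x) + (1 + x)⁻¹ - 1 := by
  unfold sFun
  field_simp
  ring

/-- For fixed product `p = x * y`, the sum `s(x) + s(y)` depends only on `T = (1 + x) * (1 + y)`. -/
theorem sFun_add_sFun {x y : ℝ} (hx : 0 < x) (hy : 0 < y) :
    sFun x + sFun y =
      Real.log ((1 + x) * (1 + y)) + (1 - x * y) / ((1 + x) * (1 + y)) - 1 := by
  rw [sFun_eq_log_add_inv hx, sFun_eq_log_add_inv hy,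
    Real.log_mul (by positivity) (by positivity)]
  field_simp
  ring

/-- `T ↦ log T + (1 - p) / T` is strictly increasing where `1 - p < T`. -/
theorem log_add_div_lt_log_add_div {p a b : ℝ} (ha : 0 < a) (hab : a < b) (hp : 1 - p < a) :
    Real.log a + (1 - p) / a < Real.log b + (1 - p) / b := by
  have hb : 0 < b := ha.trans hab
  have hlog := Real.one_sub_inv_le_log_of_pos (div_pos hb ha)
  rw [Real.log_div hb.ne' ha.ne', inv_div] at hlog
  have hpos : 0 < (b - a) * (a - (1 - p)) / (a * b) :=
    div_pos (mul_pos (sub_pos.2 hab) (sub_pos.2 hp)) (mul_pos ha hb)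
  have hid : (b - a) * (a - (1 - p)) / (a * b) =
      1 - a / b + (1 - p) / b - (1 - p) / a := by
    field_simp
    ring
  linarith

theorem two_mul_sFun_lt {z x : ℝ} (hz : 0 < z) (hx : 0 < x) (hne : x ≠ z) :
    2 * sFun z < sFun x + sFun (z ^ 2 / x) := by
  have hxy : x * (z ^ 2 / x) = z * z := by field_simp
  have hlt : (1 + z) * (1 + z) < (1 + x) * (1 + z ^ 2 / x) := by
    have hpos : 0 < (x - z) ^ 2 / x := div_pos (sq_pos_of_ne_zero (sub_ne_zero.2 hne)) hx
    have hid : (x - z) ^ 2 / x = (1 + x) * (1 + z ^ 2 / x) - (1 + z) * (1 + z) := by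
      field_simp
      ring
    linarith
  have key := log_add_div_lt_log_add_div (p := z * z) (by positivity) hlt (by nlinarith)
  rw [two_mul, sFun_add_sFun hz hz, sFun_add_sFun hx (by positivity), hxy]
  linarith

/-- For every `z > 0` and every `x > 0` one has
`s(x) + s(z²/x) ≥ 2·s(z)`, with equality if and only if `x = z`. -/
theorem stmt_12 :
    ∀ z > (0 : ℝ), ∀ x > (0 : ℝ),
      2 * sFun z ≤ sFun x + sFun (z ^ 2 / x) ∧
        (sFun x + sFun (z ^ 2 / x) = 2 * sFun z ↔ x = z) := by
  intro z hz x hx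
  rcases eq_or_ne x z with rfl | hne
  · have hxx : x ^ 2 / x = x := by field_simp
    rw [hxx, ← two_mul]
    exact ⟨le_rfl, by simp⟩
  · have hlt := two_mul_sFun_lt hz hx hne
    exact ⟨hlt.le, fun h => absurd h hlt.ne', fun h => absurd h hne⟩
end

section
/- Let ħ > 0 and α ∈ ℝ. Let v₁, v₂ > 0 satisfy v₁·v₂ ≥ (ħ²/4)·cos²α, and let V₁₁, V₂₂ ≥ 0 satisfy V₁₁·V₂₂ ≥ (ħ²/4)·cos²α. Then for all m₁, m₂, a, b ∈ ℝ, the sum of Kullback–Leibler divergences klDiv(N(m₁, v₁), N(m₁ + a, v₁ + V₁₁)) + klDiv(N(m₂, v₂), N(m₂ + b, v₂ + V₂₂)) is at least s(z), where z = ħ·|cos α| / (2·√(v₁·v₂)) and s(x) = ln(1 + x) − x/(1 + x). -/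
open MeasureTheory ProbabilityTheory
open scoped ENNReal Classical

/-- The Kullback–Leibler divergence `klDiv p q = ∫ ln (dp/dq) dp` (natural logarithm), valued
in the extended nonnegative reals and equal to `+∞` when `p` is not absolutely continuous with
respect to `q` (or the log-likelihood ratio is not integrable). -/
noncomputable def klDiv {α : Type*} [MeasurableSpace α] (p q : Measure α) : ℝ≥0∞ :=
  if p ≪ q ∧ Integrable (llr p q) p then ENNReal.ofReal (∫ x, llr p q x ∂p) else ⊤

open scoped NNReal

lemma integrable_sub_sq_gaussianReal (m c : ℝ) (v : ℝ≥0) :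
    Integrable (fun x ↦ (x - c) ^ 2) (gaussianReal m v) :=
  ((memLp_id_gaussianReal 2).sub (memLp_const c)).integrable_sq

lemma integral_sub_sq_gaussianReal (m c : ℝ) (v : ℝ≥0) :
    ∫ x, (x - c) ^ 2 ∂gaussianReal m v = v + (m - c) ^ 2 := by
  have hvar : ∫ x, (x - m) ^ 2 ∂gaussianReal m v = v := by
    have h := variance_fun_id_gaussianReal (μ := m) (v := v)
    rw [variance_eq_integral measurable_id'.aemeasurable] at h
    simpa only [integral_id_gaussianReal] using h
  have hid : Integrable (fun x : ℝ ↦ x) (gaussianReal m v) :=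
    (memLp_id_gaussianReal (μ := m) (v := v) 1).integrable (by simp)
  have hlin_int : Integrable (fun x ↦ 2 * (m - c) * (x - m)) (gaussianReal m v) :=
    (hid.sub (integrable_const m)).const_mul _
  have hlin_int' : Integrable (fun x ↦ 2 * (m - c) * (x - m) + (m - c) ^ 2) (gaussianReal m v) :=
    hlin_int.add (integrable_const _)
  have hlin : ∫ x, (2 * (m - c) * (x - m) + (m - c) ^ 2) ∂gaussianReal m v = (m - c) ^ 2 := by
    rw [integral_add hlin_int (integrable_const _), integral_const_mul,
      integral_sub hid (integrable_const m)]
    simp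
  calc ∫ x, (x - c) ^ 2 ∂gaussianReal m v
      = ∫ x, ((x - m) ^ 2 + (2 * (m - c) * (x - m) + (m - c) ^ 2)) ∂gaussianReal m v := by
        congr with x; ring
    _ = v + (m - c) ^ 2 := by
        rw [integral_add (integrable_sub_sq_gaussianReal m m v) hlin_int', hvar, hlin]

lemma log_gaussianPDFReal (m : ℝ) {v : ℝ≥0} (hv : v ≠ 0) (x : ℝ) :
    Real.log (gaussianPDFReal m v x)
      = -(Real.log (2 * Real.pi) + Real.log v) / 2 - (x - m) ^ 2 / (2 * v) := by
  have hv' : (0 : ℝ) < v := by positivity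
  have hpi := Real.pi_pos
  rw [gaussianPDFReal, Real.log_mul (by positivity) (by positivity), Real.log_exp, Real.log_inv,
    Real.log_sqrt (by positivity), Real.log_mul (by positivity) (by positivity)]
  ring

lemma gaussianReal_absolutelyContinuous_gaussianReal (m n : ℝ) {v w : ℝ≥0}
    (hv : v ≠ 0) (hw : w ≠ 0) : gaussianReal m v ≪ gaussianReal n w :=
  (gaussianReal_absolutelyContinuous m hv).trans (gaussianReal_absolutelyContinuous' n hw)

lemma llr_gaussianReal (m n : ℝ) {v w : ℝ≥0} (hv : v ≠ 0) (hw : w ≠ 0) :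
    llr (gaussianReal m v) (gaussianReal n w) =ᵐ[gaussianReal m v] fun x ↦
      (Real.log w - Real.log v) / 2 - (x - m) ^ 2 / (2 * v) + (x - n) ^ 2 / (2 * w) := by
  have hmv := gaussianReal_absolutelyContinuous m hv
  have hnw := gaussianReal_absolutelyContinuous n hw
  have hac := gaussianReal_absolutelyContinuous_gaussianReal m n hv hw
  filter_upwards [hac (Measure.rnDeriv_eq_div hmv hnw), hmv (rnDeriv_gaussianReal m v),
    hmv (rnDeriv_gaussianReal n w)] with x h hp hq
  rw [llr, h, hp, hq, ENNReal.toReal_div, toReal_gaussianPDF, toReal_gaussianPDF,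
    Real.log_div (gaussianPDFReal_pos m v x hv).ne' (gaussianPDFReal_pos n w x hw).ne',
    log_gaussianPDFReal m hv, log_gaussianPDFReal n hw]
  ring

lemma klDiv_gaussianReal (m n : ℝ) {v w : ℝ≥0} (hv : v ≠ 0) (hw : w ≠ 0) :
    klDiv (gaussianReal m v) (gaussianReal n w) = ENNReal.ofReal
      ((Real.log w - Real.log v + (v + (m - n) ^ 2) / w - 1) / 2) := by
  have hv' : (v : ℝ) ≠ 0 := by exact_mod_cast hv
  have hw' : (w : ℝ) ≠ 0 := by exact_mod_cast hw
  have hm := (integrable_sub_sq_gaussianReal m m v).div_const (2 * (v : ℝ))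
  have hn := (integrable_sub_sq_gaussianReal m n v).div_const (2 * (w : ℝ))
  have hc : Integrable (fun _ : ℝ ↦ (Real.log w - Real.log v) / 2) (gaussianReal m v) :=
    integrable_const _
  have hcm : Integrable (fun x ↦ (Real.log w - Real.log v) / 2 - (x - m) ^ 2 / (2 * v))
      (gaussianReal m v) := hc.sub hm
  have hllr := llr_gaussianReal m n hv hw
  rw [klDiv, if_pos ⟨gaussianReal_absolutelyContinuous_gaussianReal m n hv hw,
    (integrable_congr hllr).2 (hcm.add hn)⟩, integral_congr_ae hllr,
    integral_add hcm hn, integral_sub hc hm, integral_div, integral_div, integral_div,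
    integral_sub_sq_gaussianReal, integral_sub_sq_gaussianReal]
  congr 1
  simp only [integral_const, probReal_univ, smul_eq_mul, one_mul]
  field_simp
  ring

lemma sFun_half_le_klDiv_gaussianReal (m c : ℝ) {v V : ℝ} (hv : 0 < v) (hV : 0 ≤ V) :
    ENNReal.ofReal (sFun (V / v) / 2) ≤
      klDiv (gaussianReal m v.toNNReal) (gaussianReal (m + c) (v + V).toNNReal) := by
  have hw : 0 < v + V := by positivity
  rw [klDiv_gaussianReal _ _ (Real.toNNReal_pos.2 hv).ne' (Real.toNNReal_pos.2 hw).ne',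
    Real.coe_toNNReal _ hv.le, Real.coe_toNNReal _ hw.le]
  refine ENNReal.ofReal_le_ofReal ?_
  have h₁ : 1 + V / v = (v + V) / v := by field_simp
  have h₂ : V / v / ((v + V) / v) = 1 - v / (v + V) := by field_simp; ring
  have h₃ : 0 ≤ c ^ 2 / (v + V) := by positivity
  have h₄ : (v + (m - (m + c)) ^ 2) / (v + V) = v / (v + V) + c ^ 2 / (v + V) := by ring
  rw [sFun, h₁, h₂, Real.log_div hw.ne' hv.ne', h₄]
  linarith

lemma sFun_nonneg {x : ℝ} (hx : 0 ≤ x) : 0 ≤ sFun x := by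
  have h := Real.one_sub_inv_le_log_of_pos (show 0 < 1 + x by positivity)
  have h' : x / (1 + x) = 1 - (1 + x)⁻¹ := by field_simp; ring
  rw [sFun, h']
  linarith

/-- The tangent line bound for the convex function `t ↦ sFun (exp t)`. -/
lemma sFun_add_mul_log_sub_log_le {x z : ℝ} (hx : 0 < x) (hz : 0 < z) :
    sFun z + (z / (1 + z)) ^ 2 * (Real.log x - Real.log z) ≤ sFun x := by
  have hx' : 0 < 1 + x := by positivity
  have hz' : 0 < 1 + z := by positivity
  have h₁ := Real.log_le_sub_one_of_pos (div_pos hz' hx')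
  have h₂ := Real.log_le_sub_one_of_pos (div_pos (mul_pos hx hz') (mul_pos hz hx'))
  rw [Real.log_div hz'.ne' hx'.ne'] at h₁
  rw [Real.log_div (by positivity) (by positivity), Real.log_mul hx.ne' hz'.ne',
    Real.log_mul hz.ne' hx'.ne'] at h₂
  have hc : 0 ≤ 1 - (z / (1 + z)) ^ 2 := by
    have : 1 - (z / (1 + z)) ^ 2 = (1 + 2 * z) / (1 + z) ^ 2 := by field_simp; ring
    rw [this]; positivity
  have h := add_le_add (mul_le_mul_of_nonneg_left h₁ hc)
    (mul_le_mul_of_nonneg_left h₂ (sq_nonneg (z / (1 + z))))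
  have key : (1 - (z / (1 + z)) ^ 2) * ((1 + z) / (1 + x) - 1)
      + (z / (1 + z)) ^ 2 * (x * (1 + z) / (z * (1 + x)) - 1)
      = z / (1 + z) - x / (1 + x) := by
    field_simp; ring
  rw [key] at h
  simp only [sFun]
  linarith

lemma sFun_le_half_add_half {x y z : ℝ} (hx : 0 ≤ x) (hy : 0 ≤ y) (hz : 0 ≤ z)
    (h : z ^ 2 ≤ x * y) : sFun z ≤ sFun x / 2 + sFun y / 2 := by
  rcases hz.eq_or_lt with rfl | hz
  · have h₀ : sFun 0 = 0 := by simp [sFun]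
    linarith [sFun_nonneg hx, sFun_nonneg hy]
  have hxy : 0 < x * y := (pow_pos hz 2).trans_le h
  have hx : 0 < x := pos_of_mul_pos_left hxy hy
  have hy : 0 < y := pos_of_mul_pos_right hxy hx.le
  have hlog := Real.log_le_log (pow_pos hz 2) h
  rw [Real.log_pow, Real.log_mul hx.ne' hy.ne'] at hlog
  push_cast at hlog
  have := mul_nonneg (sq_nonneg (z / (1 + z))) (sub_nonneg.2 hlog)
  linarith [sFun_add_mul_log_sub_log_le hx hz, sFun_add_mul_log_sub_log_le hy hz]

/-- State dependent entropic MUR, scalar case: for admissible preparation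
variances `v₁, v₂` and admissible noise variances `V₁₁, V₂₂`, the sum of the two
Kullback–Leibler divergences is at least `s(z)`, `z = ħ|cos α|/(2√(v₁v₂))`. -/
theorem stmt_13 (hbar α v₁ v₂ V₁₁ V₂₂ m₁ m₂ a b : ℝ) (hhbar : 0 < hbar)
    (hv₁ : 0 < v₁) (hv₂ : 0 < v₂)
    (hv : hbar ^ 2 / 4 * Real.cos α ^ 2 ≤ v₁ * v₂)
    (hV₁ : 0 ≤ V₁₁) (hV₂ : 0 ≤ V₂₂)
    (hV : hbar ^ 2 / 4 * Real.cos α ^ 2 ≤ V₁₁ * V₂₂) :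
    ENNReal.ofReal (sFun (hbar * |Real.cos α| / (2 * Real.sqrt (v₁ * v₂)))) ≤
      klDiv (gaussianReal m₁ v₁.toNNReal) (gaussianReal (m₁ + a) (v₁ + V₁₁).toNNReal) +
        klDiv (gaussianReal m₂ v₂.toNNReal) (gaussianReal (m₂ + b) (v₂ + V₂₂).toNNReal) := by
  have hx : 0 ≤ V₁₁ / v₁ := by positivity
  have hy : 0 ≤ V₂₂ / v₂ := by positivity
  have hz : (hbar * |Real.cos α| / (2 * Real.sqrt (v₁ * v₂))) ^ 2 ≤ V₁₁ / v₁ * (V₂₂ / v₂) := by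
    rw [div_pow, mul_pow, mul_pow, sq_abs, Real.sq_sqrt (by positivity), div_mul_div_comm,
      div_le_div_iff₀ (by positivity) (by positivity)]
    nlinarith [mul_pos hv₁ hv₂]
  have hs := sFun_le_half_add_half hx hy (by positivity) hz
  calc ENNReal.ofReal (sFun (hbar * |Real.cos α| / (2 * Real.sqrt (v₁ * v₂))))
      ≤ ENNReal.ofReal (sFun (V₁₁ / v₁) / 2 + sFun (V₂₂ / v₂) / 2) :=
        ENNReal.ofReal_le_ofReal hs
    _ ≤ ENNReal.ofReal (sFun (V₁₁ / v₁) / 2) + ENNReal.ofReal (sFun (V₂₂ / v₂) / 2) :=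
        ENNReal.ofReal_add_le
    _ ≤ _ := add_le_add (sFun_half_le_klDiv_gaussianReal m₁ a hv₁ hV₁)
        (sFun_half_le_klDiv_gaussianReal m₂ b hv₂ hV₂)
end

section
/- Let ħ > 0, α ∈ ℝ, and let ε₁, ε₂ > 0 satisfy ε₁·ε₂ ≥ (ħ²/4)·cos²α. For V₁₁, V₂₂ ≥ 0 and a, b ∈ ℝ define G(V₁₁, V₂₂, a, b) = (1/2)·[s(V₁₁/ε₁) + s(V₂₂/ε₂)] + a²/(2·(V₁₁ + ε₁)) + b²/(2·(V₂₂ + ε₂)), where s(x) = ln(1 + x) − x/(1 + x). Then over all V₁₁, V₂₂ ≥ 0 with V₁₁·V₂₂ ≥ (ħ²/4)·cos²α and all a, b ∈ ℝ, one has G(V₁₁, V₂₂, a, b) ≥ s(z) with z = ħ·|cos α|/(2·√(ε₁·ε₂)), and equality holds exactly for a = 0, b = 0, V₁₁ = (ħ·|cos α|/2)·√(ε₁/ε₂), V₂₂ = (ħ·|cos α|/2)·√(ε₂/ε₁); hence the infimum of G over this set equals s(z) and is attained at a unique point when cos α ≠ 0. -/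
/-- The divergence value `G(V₁₁, V₂₂, a, b)` (in nats) associated with the thresholds
`ε₁, ε₂` and a Gaussian covariant bi-observable with noise means `a, b` and noise variances
`V₁₁, V₂₂`. -/
noncomputable def divG (ε₁ ε₂ V₁₁ V₂₂ a b : ℝ) : ℝ :=
  (1 / 2) * (sFun (V₁₁ / ε₁) + sFun (V₂₂ / ε₂)) +
    a ^ 2 / (2 * (V₁₁ + ε₁)) + b ^ 2 / (2 * (V₂₂ + ε₂))

theorem sFun_zero : sFun 0 = 0 := by
  simp [sFun]

theorem sFun_pos {u : ℝ} (hu : 0 < u) : 0 < sFun u := by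
  have h := Real.log_lt_sub_one_of_pos (x := (1 + u)⁻¹) (by positivity)
    (by rw [ne_eq, inv_eq_one]; linarith)
  rw [Real.log_inv] at h
  have e : u / (1 + u) = 1 - (1 + u)⁻¹ := by field_simp; ring
  rw [sFun, e]
  linarith

/-- The graph of `t ↦ sFun (exp t)` lies strictly above its tangent at `t = log z`. -/
theorem sFun_tangent_lt {z u : ℝ} (hz : 0 < z) (hu : 0 < u) (hne : u ≠ z) :
    sFun z + (z / (1 + z)) ^ 2 * (Real.log u - Real.log z) < sFun u := by
  have hz1 : 0 < 1 + z := by linarith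
  have hu1 : 0 < 1 + u := by linarith
  have h₁ := Real.log_lt_sub_one_of_pos (x := (1 + z) / (1 + u)) (by positivity) (by
    rw [ne_eq, div_eq_one_iff_eq hu1.ne']
    intro h
    exact hne (by linarith))
  have h₂ := Real.log_le_sub_one_of_pos (x := u * (1 + z) / (z * (1 + u))) (by positivity)
  rw [Real.log_div hz1.ne' hu1.ne'] at h₁
  rw [Real.log_div (by positivity) (by positivity), Real.log_mul hu.ne' hz1.ne',
    Real.log_mul hz.ne' hu1.ne'] at h₂
  have hc : (z / (1 + z)) ^ 2 < 1 := by
    rw [div_pow, div_lt_one (by positivity)]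
    nlinarith
  have h₃ := mul_lt_mul_of_pos_left h₁ (sub_pos.2 hc)
  have h₄ := mul_le_mul_of_nonneg_left h₂ (sq_nonneg (z / (1 + z)))
  have e : (1 - (z / (1 + z)) ^ 2) * ((1 + z) / (1 + u) - 1) +
      (z / (1 + z)) ^ 2 * (u * (1 + z) / (z * (1 + u)) - 1) = z / (1 + z) - u / (1 + u) := by
    field_simp
    ring
  unfold sFun
  linarith

theorem sFun_tangent_le {z u : ℝ} (hz : 0 < z) (hu : 0 < u) :
    sFun z + (z / (1 + z)) ^ 2 * (Real.log u - Real.log z) ≤ sFun u := by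
  rcases eq_or_ne u z with rfl | hne
  · simp
  · exact (sFun_tangent_lt hz hu hne).le

theorem two_mul_sFun_lt_add {z u v : ℝ} (hz : 0 ≤ z) (hu : 0 ≤ u) (hv : 0 ≤ v)
    (h : z ^ 2 ≤ u * v) (hne : ¬(u = z ∧ v = z)) : 2 * sFun z < sFun u + sFun v := by
  rcases hz.eq_or_lt with rfl | hz
  · rw [sFun_zero]
    rcases hu.eq_or_lt with rfl | hu
    · have hv' : 0 < v := lt_of_le_of_ne hv fun h => hne ⟨rfl, h.symm⟩
      have := sFun_pos hv'
      rw [sFun_zero]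
      linarith
    · have := sFun_pos hu
      rcases hv.eq_or_lt with rfl | hv
      · rw [sFun_zero]
        linarith
      · have := sFun_pos hv
        linarith
  · have huv : 0 < u * v := lt_of_lt_of_le (by positivity) h
    have hu : 0 < u := pos_of_mul_pos_left huv hv
    have hv : 0 < v := pos_of_mul_pos_right huv hu.le
    have hlog := Real.log_le_log (by positivity) h
    rw [Real.log_pow, Real.log_mul hu.ne' hv.ne'] at hlog
    push_cast at hlog
    have hc := mul_nonneg (sq_nonneg (z / (1 + z))) (sub_nonneg.2 hlog)
    have h₁ := sFun_tangent_le hz hu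
    have h₂ := sFun_tangent_le hz hv
    by_cases huz : u = z
    · have := sFun_tangent_lt hz hv fun hvz => hne ⟨huz, hvz⟩
      linarith
    · have := sFun_tangent_lt hz hu huz
      linarith


/-- For thresholds `ε₁ε₂ ≥ (ħ²/4)cos²α`, over all admissible noise variances
`V₁₁, V₂₂` (with `V₁₁V₂₂ ≥ (ħ²/4)cos²α`) and all biases `a, b`, one has `G ≥ s(z)` with
`z = ħ|cos α|/(2√(ε₁ε₂))`, with equality exactly at `a = 0`, `b = 0`,
`V₁₁ = (ħ|cos α|/2)√(ε₁/ε₂)`, `V₂₂ = (ħ|cos α|/2)√(ε₂/ε₁)`. -/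
theorem stmt_16 (hbar α ε₁ ε₂ : ℝ) (hhbar : 0 < hbar) (hε₁ : 0 < ε₁) (hε₂ : 0 < ε₂)
    (hεε : hbar ^ 2 / 4 * Real.cos α ^ 2 ≤ ε₁ * ε₂) :
    ∀ V₁₁ V₂₂ a b : ℝ, 0 ≤ V₁₁ → 0 ≤ V₂₂ →
      hbar ^ 2 / 4 * Real.cos α ^ 2 ≤ V₁₁ * V₂₂ →
      (sFun (hbar * |Real.cos α| / (2 * Real.sqrt (ε₁ * ε₂))) ≤ divG ε₁ ε₂ V₁₁ V₂₂ a b ∧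
        (divG ε₁ ε₂ V₁₁ V₂₂ a b = sFun (hbar * |Real.cos α| / (2 * Real.sqrt (ε₁ * ε₂))) ↔
          a = 0 ∧ b = 0 ∧
            V₁₁ = hbar * |Real.cos α| / 2 * Real.sqrt (ε₁ / ε₂) ∧
            V₂₂ = hbar * |Real.cos α| / 2 * Real.sqrt (ε₂ / ε₁))) := by
  intro V₁ V₂ a b hV₁ hV₂ hV
  obtain ⟨x, hx, rfl⟩ : ∃ x : ℝ, 0 < x ∧ x ^ 2 = ε₁ :=
    ⟨√ε₁, Real.sqrt_pos.2 hε₁, Real.sq_sqrt hε₁.le⟩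
  obtain ⟨y, hy, rfl⟩ : ∃ y : ℝ, 0 < y ∧ y ^ 2 = ε₂ :=
    ⟨√ε₂, Real.sqrt_pos.2 hε₂, Real.sq_sqrt hε₂.le⟩
  rw [← mul_pow, ← div_pow, ← div_pow, Real.sqrt_sq (by positivity), Real.sqrt_sq (by positivity),
    Real.sqrt_sq (by positivity)]
  set z := hbar * |Real.cos α| / (2 * (x * y)) with hz
  have hz0 : 0 ≤ z := by positivity
  have e₁ : V₁ = hbar * |Real.cos α| / 2 * (x / y) ↔ V₁ / x ^ 2 = z := by
    rw [div_eq_iff hε₁.ne', show z * x ^ 2 = hbar * |Real.cos α| / 2 * (x / y) by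
      rw [hz]; field_simp]
  have e₂ : V₂ = hbar * |Real.cos α| / 2 * (y / x) ↔ V₂ / y ^ 2 = z := by
    rw [div_eq_iff hε₂.ne', show z * y ^ 2 = hbar * |Real.cos α| / 2 * (y / x) by
      rw [hz]; field_simp]
  rw [e₁, e₂]
  have huv : z ^ 2 ≤ V₁ / x ^ 2 * (V₂ / y ^ 2) := by
    have e : z ^ 2 = hbar ^ 2 / 4 * Real.cos α ^ 2 / (x ^ 2 * y ^ 2) := by
      rw [hz, div_pow, mul_pow, sq_abs]
      field_simp
      ring
    rw [e, div_mul_div_comm]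
    gcongr
  have hu : 0 ≤ V₁ / x ^ 2 := by positivity
  have hv : 0 ≤ V₂ / y ^ 2 := by positivity
  have ha : 0 ≤ a ^ 2 / (2 * (V₁ + x ^ 2)) := by positivity
  have hb : 0 ≤ b ^ 2 / (2 * (V₂ + y ^ 2)) := by positivity
  unfold divG
  by_cases heq : V₁ / x ^ 2 = z ∧ V₂ / y ^ 2 = z
  · rw [heq.1, heq.2]
    refine ⟨by linarith, fun h => ?_, ?_⟩
    · have ha0 : a ^ 2 / (2 * (V₁ + x ^ 2)) = 0 := by linarith
      have hb0 : b ^ 2 / (2 * (V₂ + y ^ 2)) = 0 := by linarith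
      rw [div_eq_zero_iff, or_iff_left (by positivity), sq_eq_zero_iff] at ha0 hb0
      exact ⟨ha0, hb0, rfl, rfl⟩
    · rintro ⟨rfl, rfl, -, -⟩
      ring
  · have h := two_mul_sFun_lt_add hz0 hu hv huv heq
    exact ⟨by linarith, fun h' => by linarith, fun h' => absurd h'.2.2 heq⟩
end

section
/- Let ħ > 0 and α ∈ ℝ with cos α ≠ 0, and let ε₁, ε₂ > 0 satisfy ε₁·ε₂ < (ħ²/4)·cos²α. Set v₁ = ε₁ and v₂ = ħ²·cos²α/(4·ε₁). For V₁₁, V₂₂ ≥ 0 and a, b ∈ ℝ define F(V₁₁, V₂₂, a, b) = (1/2)·[s(V₁₁/v₁) + s(V₂₂/v₂)] + a²/(2·(V₁₁ + v₁)) + b²/(2·(V₂₂ + v₂)), where s(x) = ln(1 + x) − x/(1 + x). Then over all V₁₁, V₂₂ ≥ 0 with V₁₁·V₂₂ ≥ (ħ²/4)·cos²α and all a, b ∈ ℝ, one has F(V₁₁, V₂₂, a, b) ≥ ln 2 − 1/2, with equality exactly for a = 0, b = 0, V₁₁ = ε₁, V₂₂ = ħ²·cos²α/(4·ε₁); hence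 the infimum equals ln 2 − 1/2. -/
/-- The error function value `F(V₁₁, V₂₂, a, b)` (in nats) for a Gaussian preparation with
position and momentum variances `v₁, v₂` and a Gaussian covariant bi-observable with noise
means `a, b` and noise variances `V₁₁, V₂₂`. -/
noncomputable def errF (v₁ v₂ V₁₁ V₂₂ a b : ℝ) : ℝ :=
  (1 / 2) * (sFun (V₁₁ / v₁) + sFun (V₂₂ / v₂)) +
    a ^ 2 / (2 * (V₁₁ + v₁)) + b ^ 2 / (2 * (V₂₂ + v₂))

/-- A lower bound for `s(x) + s(y)` that depends on `x + y` only. -/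
theorem log_sub_one_le_sFun_add_sFun {x y : ℝ} (hx : 0 ≤ x) (hy : 0 ≤ y) :
    Real.log (2 + x + y) - 1 ≤ sFun x + sFun y := by
  have ht : 0 < 2 + x + y := by positivity
  have hx1 : 0 < 1 + x := by positivity
  have hy1 : 0 < 1 + y := by positivity
  set p := (1 + x) * (1 + y) with hp
  have hp0 : 0 < p := by positivity
  have hlog : 1 - (2 + x + y) / p ≤ Real.log (p / (2 + x + y)) := by
    simpa [inv_div] using Real.one_sub_inv_le_log_of_pos (div_pos hp0 ht)
  rw [Real.log_div hp0.ne' ht.ne'] at hlog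
  have hfrac : x / (1 + x) + y / (1 + y) = 2 - (2 + x + y) / p := by
    rw [hp]
    field_simp
    ring
  have hsplit : Real.log p = Real.log (1 + x) + Real.log (1 + y) :=
    Real.log_mul hx1.ne' hy1.ne'
  unfold sFun
  linarith

theorem two_le_add_of_one_le_mul {x y : ℝ} (hx : 0 ≤ x) (hy : 0 ≤ y) (hxy : 1 ≤ x * y) :
    2 ≤ x + y := by
  nlinarith [sq_nonneg (x - y)]

theorem log_four_eq_two_mul_log_two : Real.log 4 = 2 * Real.log 2 := by
  rw [show (4 : ℝ) = 2 ^ 2 by norm_num, Real.log_pow]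
  norm_num

theorem two_mul_log_two_sub_one_le_sFun_add_sFun {x y : ℝ} (hx : 0 ≤ x) (hy : 0 ≤ y)
    (hxy : 1 ≤ x * y) : 2 * Real.log 2 - 1 ≤ sFun x + sFun y := by
  have hle : Real.log 4 ≤ Real.log (2 + x + y) :=
    Real.log_le_log (by norm_num) (by linarith [two_le_add_of_one_le_mul hx hy hxy])
  linarith [log_sub_one_le_sFun_add_sFun hx hy, log_four_eq_two_mul_log_two]

theorem eq_one_of_sFun_add_sFun_le {x y : ℝ} (hx : 0 ≤ x) (hy : 0 ≤ y) (hxy : 1 ≤ x * y)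
    (h : sFun x + sFun y ≤ 2 * Real.log 2 - 1) : x = 1 ∧ y = 1 := by
  have hle : Real.log (2 + x + y) ≤ Real.log 4 := by
    linarith [log_sub_one_le_sFun_add_sFun hx hy, log_four_eq_two_mul_log_two]
  rw [Real.log_le_log_iff (by positivity) (by norm_num)] at hle
  have hsum : x + y = 2 := by linarith [two_le_add_of_one_le_mul hx hy hxy]
  obtain rfl : y = 2 - x := by linarith
  have hx1 : x = 1 := by nlinarith [sq_nonneg (x - 1)]
  exact ⟨hx1, by linarith⟩

theorem sFun_one : sFun 1 = Real.log 2 - 1 / 2 := by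
  norm_num [sFun]

theorem log_two_sub_half_le_errF {v₁ v₂ V₁₁ V₂₂ : ℝ} (a b : ℝ) (hv₁ : 0 < v₁) (hv₂ : 0 < v₂)
    (hV₁ : 0 ≤ V₁₁) (hV₂ : 0 ≤ V₂₂) (hV : v₁ * v₂ ≤ V₁₁ * V₂₂) :
    Real.log 2 - 1 / 2 ≤ errF v₁ v₂ V₁₁ V₂₂ a b ∧
      (errF v₁ v₂ V₁₁ V₂₂ a b = Real.log 2 - 1 / 2 ↔
        a = 0 ∧ b = 0 ∧ V₁₁ = v₁ ∧ V₂₂ = v₂) := by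
  have hx : 0 ≤ V₁₁ / v₁ := by positivity
  have hy : 0 ≤ V₂₂ / v₂ := by positivity
  have hxy : 1 ≤ V₁₁ / v₁ * (V₂₂ / v₂) := by
    rw [div_mul_div_comm, le_div_iff₀ (by positivity)]
    linarith
  have ha : 0 ≤ a ^ 2 / (2 * (V₁₁ + v₁)) := by positivity
  have hb : 0 ≤ b ^ 2 / (2 * (V₂₂ + v₂)) := by positivity
  have hs := two_mul_log_two_sub_one_le_sFun_add_sFun hx hy hxy
  unfold errF
  refine ⟨by linarith, fun h => ?_, ?_⟩
  · have ha0 : a ^ 2 / (2 * (V₁₁ + v₁)) = 0 := by linarith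
    have hb0 : b ^ 2 / (2 * (V₂₂ + v₂)) = 0 := by linarith
    obtain ⟨h₁, h₂⟩ := eq_one_of_sFun_add_sFun_le hx hy hxy (by linarith)
    rw [div_eq_one_iff_eq hv₁.ne'] at h₁
    rw [div_eq_one_iff_eq hv₂.ne'] at h₂
    rw [div_eq_zero_iff, or_iff_left (by positivity)] at ha0 hb0
    exact ⟨pow_eq_zero_iff two_ne_zero |>.1 ha0, pow_eq_zero_iff two_ne_zero |>.1 hb0, h₁, h₂⟩
  · rintro ⟨rfl, rfl, rfl, rfl⟩
    rw [div_self hv₁.ne', div_self hv₂.ne', sFun_one]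
    ring

/-- For thresholds with `ε₁ε₂ < (ħ²/4)cos²α` and the minimum-uncertainty
preparation `v₁ = ε₁`, `v₂ = ħ²cos²α/(4ε₁)`, over all admissible noise variances
`V₁₁, V₂₂` (with `V₁₁V₂₂ ≥ (ħ²/4)cos²α`) and all biases `a, b`, one has
`F ≥ ln 2 − 1/2`, with equality exactly at `a = 0`, `b = 0`, `V₁₁ = ε₁`,
`V₂₂ = ħ²cos²α/(4ε₁)`. -/
theorem stmt_17 (hbar α ε₁ ε₂ : ℝ) (hhbar : 0 < hbar) (hcos : Real.cos α ≠ 0)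
    (hε₁ : 0 < ε₁) (hε₂ : 0 < ε₂)
    (hεε : ε₁ * ε₂ < hbar ^ 2 / 4 * Real.cos α ^ 2) :
    ∀ V₁₁ V₂₂ a b : ℝ, 0 ≤ V₁₁ → 0 ≤ V₂₂ →
      hbar ^ 2 / 4 * Real.cos α ^ 2 ≤ V₁₁ * V₂₂ →
      (Real.log 2 - 1 / 2 ≤
          errF ε₁ (hbar ^ 2 * Real.cos α ^ 2 / (4 * ε₁)) V₁₁ V₂₂ a b ∧
        (errF ε₁ (hbar ^ 2 * Real.cos α ^ 2 / (4 * ε₁)) V₁₁ V₂₂ a b = Real.log 2 - 1 / 2 ↔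
          a = 0 ∧ b = 0 ∧ V₁₁ = ε₁ ∧
            V₂₂ = hbar ^ 2 * Real.cos α ^ 2 / (4 * ε₁))) := by
  intro V₁₁ V₂₂ a b hV₁ hV₂ hV
  have hv₂ : 0 < hbar ^ 2 * Real.cos α ^ 2 / (4 * ε₁) := by positivity
  refine log_two_sub_half_le_errF a b hε₁ hv₂ hV₁ hV₂ (le_of_eq_of_le ?_ hV)
  field_simp
end

section
/- Define s : ℝ → ℝ by s(x) = ln(1 + x) − x/(1 + x). Let c > 0 and let λ₁, …, λ_n be positive real numbers. Then ∑_{i=1}^{n} [s(λ_i) + s(c/λ_i)] ≥ 2·n·s(√c), with equality if and only if λ_i = √c for every i. -/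
theorem two_mul_sFun_add_le_sFun_add_sFun_div {q x : ℝ} (hq : 0 < q) (hx : 0 < x) :
    2 * sFun q + 2 * q * (x - q) ^ 2 / ((1 + x) * (x + q ^ 2) * (1 + q)) ≤
      sFun x + sFun (q ^ 2 / x) := by
  have hlog : 1 - ((1 + x) * (1 + q ^ 2 / x) / (1 + q) ^ 2)⁻¹ ≤
      Real.log (1 + x) + Real.log (1 + q ^ 2 / x) - 2 * Real.log (1 + q) := by
    have h := Real.one_sub_inv_le_log_of_pos
      (show 0 < (1 + x) * (1 + q ^ 2 / x) / (1 + q) ^ 2 by positivity)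
    rw [Real.log_div (by positivity) (by positivity),
      Real.log_mul (by positivity) (by positivity), Real.log_pow] at h
    exact_mod_cast h
  have hgap : 2 * q * (x - q) ^ 2 / ((1 + x) * (x + q ^ 2) * (1 + q)) =
      1 - ((1 + x) * (1 + q ^ 2 / x) / (1 + q) ^ 2)⁻¹ + 2 * (q / (1 + q)) -
        x / (1 + x) - q ^ 2 / x / (1 + q ^ 2 / x) := by
    have : x + q ^ 2 ≠ 0 := by positivity
    field_simp
    ring
  unfold sFun
  linarith

theorem two_mul_sFun_le_sFun_add_sFun_div {q x : ℝ} (hq : 0 < q) (hx : 0 < x) :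
    2 * sFun q ≤ sFun x + sFun (q ^ 2 / x) :=
  le_trans (le_add_of_nonneg_right (by positivity)) (two_mul_sFun_add_le_sFun_add_sFun_div hq hx)

theorem sFun_add_sFun_div_eq_iff {q x : ℝ} (hq : 0 < q) (hx : 0 < x) :
    2 * sFun q = sFun x + sFun (q ^ 2 / x) ↔ x = q := by
  constructor
  · intro h
    by_contra hne
    have hsub : x - q ≠ 0 := sub_ne_zero.mpr hne
    have hpos : 0 < 2 * q * (x - q) ^ 2 / ((1 + x) * (x + q ^ 2) * (1 + q)) := by positivity
    linarith [two_mul_sFun_add_le_sFun_add_sFun_div hq hx]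
  · rintro rfl
    rw [pow_two, mul_div_cancel_right₀ _ hx.ne', two_mul]

/-- For `c > 0` and positive reals `λ₁, …, λₙ`,
`∑ i, [s(λᵢ) + s(c/λᵢ)] ≥ 2·n·s(√c)`, with equality iff `λᵢ = √c` for every `i`. -/
theorem stmt_18 {n : ℕ} (c : ℝ) (hc : 0 < c) (lam : Fin n → ℝ) (hlam : ∀ i, 0 < lam i) :
    2 * (n : ℝ) * sFun (Real.sqrt c) ≤ ∑ i, (sFun (lam i) + sFun (c / lam i)) ∧
      (∑ i, (sFun (lam i) + sFun (c / lam i)) = 2 * (n : ℝ) * sFun (Real.sqrt c) ↔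
        ∀ i, lam i = Real.sqrt c) := by
  obtain ⟨q, hq, rfl⟩ : ∃ q : ℝ, 0 < q ∧ q ^ 2 = c :=
    ⟨√c, Real.sqrt_pos.mpr hc, Real.sq_sqrt hc.le⟩
  rw [Real.sqrt_sq hq.le]
  have hconst : 2 * (n : ℝ) * sFun q = ∑ _i : Fin n, 2 * sFun q := by
    simp only [Finset.sum_const, Finset.card_univ, Fintype.card_fin, nsmul_eq_mul]
    ring
  have hle : ∀ i ∈ Finset.univ, 2 * sFun q ≤ sFun (lam i) + sFun (q ^ 2 / lam i) :=
    fun i _ => two_mul_sFun_le_sFun_add_sFun_div hq (hlam i)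
  rw [hconst]
  refine ⟨Finset.sum_le_sum hle, ?_⟩
  rw [eq_comm, Finset.sum_eq_sum_iff_of_le hle]
  simp only [Finset.mem_univ, true_imp_iff, sFun_add_sFun_div_eq_iff hq (hlam _)]
end

section
/- Let ħ > 0 and let ε₁, ε₂ > 0 satisfy ε₁·ε₂ ≥ ħ²/4. Let A and B be real symmetric positive definite n×n matrices such that B − (ħ²/4)·A⁻¹ is positive semidefinite. Let μ₁, …, μ_n and ν₁, …, ν_n denote the eigenvalues of A and B respectively. Then ∑_{i=1}^{n} s(μ_i/ε₁) + ∑_{i=1}^{n} s(ν_i/ε₂) ≥ 2·n·s(ħ/(2·√(ε₁·ε₂))), where s(x) = ln(1 + x) − x/(1 + x); equality holds if and only if A = (ħ/2)·√(ε₁/ε₂)·I and B = (ħ/2)·√(ε₂/ε₁)·I. -/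
open Matrix

theorem sFun_eq {x : ℝ} (hx : 0 ≤ x) : sFun x = Real.log (1 + x) - 1 + (1 + x)⁻¹ := by
  have : (1 + x) ≠ 0 := by positivity
  unfold sFun
  field_simp
  ring

theorem sFun_strictMonoOn : StrictMonoOn sFun (Set.Ici 0) := by
  intro t ht x hx htx
  rw [Set.mem_Ici] at ht hx
  have hT : 0 < 1 + t := by positivity
  have hX : 0 < 1 + x := by positivity
  have hne : (1 + t) / (1 + x) ≠ 1 := by
    rw [Ne, div_eq_one_iff_eq hX.ne']
    linarith
  have hlog := Real.log_lt_sub_one_of_pos (div_pos hT hX) hne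
  rw [Real.log_div hT.ne' hX.ne'] at hlog
  have key : (1 + t)⁻¹ - (1 + x)⁻¹ ≤ 1 - (1 + t) / (1 + x) := by
    have : 1 - (1 + t) / (1 + x) - ((1 + t)⁻¹ - (1 + x)⁻¹)
        = t * (x - t) / ((1 + t) * (1 + x)) := by
      field_simp
      ring
    have : 0 ≤ t * (x - t) / ((1 + t) * (1 + x)) :=
      div_nonneg (mul_nonneg ht (by linarith)) (by positivity)
    linarith
  rw [sFun_eq ht, sFun_eq hx]
  linarith

theorem two_mul_sFun_lt_add_s19 {r x y : ℝ} (hr : 0 < r) (hx : 0 < x) (hy : 0 < y)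
    (hxy : x * y = r ^ 2) (hne : x ≠ y) : 2 * sFun r < sFun x + sFun y := by
  have hsum : 2 * r < x + y := by
    have : 0 < (x - y) ^ 2 := by
      have := sub_ne_zero.mpr hne
      positivity
    nlinarith
  set D := (1 + x) * (1 + y) with hD
  have hDpos : 0 < D := by positivity
  have hlt : (1 + r) ^ 2 < D := by nlinarith
  have hrpos : 0 < (1 + r) ^ 2 := by positivity
  have hlog := Real.log_lt_sub_one_of_pos (div_pos hrpos hDpos) (ne_of_lt ((div_lt_one hDpos).2 hlt))
  rw [Real.log_div hrpos.ne' hDpos.ne', Real.log_pow, hD,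
    Real.log_mul (by positivity) (by positivity), ← hD] at hlog
  push_cast at hlog
  have hinv : (1 + x)⁻¹ + (1 + y)⁻¹ = 1 + (1 - r ^ 2) / D := by
    rw [hD, ← hxy]
    field_simp
    ring
  have hinv' : 2 * (1 + r)⁻¹ = 1 + (1 - r ^ 2) / (1 + r) ^ 2 := by
    field_simp
    ring
  have key : (1 - r ^ 2) / (1 + r) ^ 2 - (1 - r ^ 2) / D ≤ 1 - (1 + r) ^ 2 / D := by
    have : 1 - (1 + r) ^ 2 / D - ((1 - r ^ 2) / (1 + r) ^ 2 - (1 - r ^ 2) / D)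
        = (D - (1 + r) ^ 2) * (2 * r ^ 2 + 2 * r) / ((1 + r) ^ 2 * D) := by
      field_simp
      ring
    have : 0 ≤ (D - (1 + r) ^ 2) * (2 * r ^ 2 + 2 * r) / ((1 + r) ^ 2 * D) :=
      div_nonneg (mul_nonneg (by linarith) (by positivity)) (by positivity)
    linarith
  rw [sFun_eq hr.le, sFun_eq hx.le, sFun_eq hy.le]
  linarith

theorem two_mul_sFun_lt_add_of_sq_le_mul {t x y : ℝ} (ht : 0 < t) (hx : 0 < x) (hy : 0 < y)
    (hxy : t ^ 2 ≤ x * y) (hne : ¬ (x = t ∧ y = t)) : 2 * sFun t < sFun x + sFun y := by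
  have hr : t ≤ √(x * y) := Real.le_sqrt_of_sq_le hxy
  have hsq : √(x * y) ^ 2 = x * y := Real.sq_sqrt (by positivity)
  have hmono := sFun_strictMonoOn.monotoneOn ht.le (ht.le.trans hr) hr
  rcases eq_or_ne x y with rfl | h
  · have hx' : √(x * x) = x := Real.sqrt_mul_self hx.le
    have : t < x := lt_of_le_of_ne (hx' ▸ hr) fun h => hne ⟨h.symm, h.symm⟩
    linarith [sFun_strictMonoOn ht.le hx.le this]
  · linarith [two_mul_sFun_lt_add_s19 (ht.trans_le hr) hx hy hsq.symm h]

theorem two_mul_sFun_le_add_of_sq_le_mul {t x y : ℝ} (ht : 0 < t) (hx : 0 < x) (hy : 0 < y)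
    (hxy : t ^ 2 ≤ x * y) : 2 * sFun t ≤ sFun x + sFun y := by
  by_cases h : x = t ∧ y = t
  · rw [h.1, h.2, two_mul]
  · exact (two_mul_sFun_lt_add_of_sq_le_mul ht hx hy hxy h).le

section Matrix

variable {n : ℕ}

theorem dotProduct_mulVec_eq_sum_of_orthonormal_eigenvectors
    (b : OrthonormalBasis (Fin n) ℝ (EuclideanSpace ℝ (Fin n))) {M : Matrix (Fin n) (Fin n) ℝ}
    (hM : M.IsSymm) {lam : Fin n → ℝ} (hb : ∀ k, M *ᵥ (b k).ofLp = lam k • (b k).ofLp)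
    (v : EuclideanSpace ℝ (Fin n)) :
    v.ofLp ⬝ᵥ M *ᵥ v.ofLp = ∑ k, lam k * inner ℝ (b k) v ^ 2 := by
  have h := b.sum_inner_mul_inner v (WithLp.toLp 2 (M *ᵥ v.ofLp))
  have hk : ∀ k, inner ℝ (b k) (WithLp.toLp 2 (M *ᵥ v.ofLp)) = lam k * inner ℝ (b k) v := by
    intro k
    simp only [EuclideanSpace.inner_eq_star_dotProduct, star_trivial]
    rw [dotProduct_comm, dotProduct_mulVec, ← mulVec_transpose, hM.eq, hb, smul_dotProduct,
      smul_eq_mul, dotProduct_comm]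
  simp only [hk] at h
  rw [EuclideanSpace.inner_eq_star_dotProduct, star_trivial, dotProduct_comm] at h
  rw [← h]
  refine Finset.sum_congr rfl fun k _ => ?_
  rw [real_inner_comm v]
  ring

theorem exists_ne_zero_inner_eq_zero (u w : Fin n → EuclideanSpace ℝ (Fin n)) (i : Fin n) :
    ∃ v : EuclideanSpace ℝ (Fin n), v ≠ 0 ∧ (∀ k, i < k → inner ℝ (u k) v = 0) ∧
      ∀ k, k.rev < i → inner ℝ (w k) v = 0 := by
  let f : {k : Fin n // k ≠ i} → EuclideanSpace ℝ (Fin n) :=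
    fun k => if i < k.1 then u k else w k.1.rev
  let L : EuclideanSpace ℝ (Fin n) →ₗ[ℝ] ({k : Fin n // k ≠ i} → ℝ) :=
    LinearMap.pi fun k => (innerSL ℝ (f k)).toLinearMap
  have hlt : Module.finrank ℝ ({k : Fin n // k ≠ i} → ℝ)
      < Module.finrank ℝ (EuclideanSpace ℝ (Fin n)) := by
    have := i.pos
    simp
    omega
  obtain ⟨v, hv, hv0⟩ := Submodule.exists_mem_ne_zero_of_ne_bot
    (LinearMap.ker_ne_bot_of_finrank_lt (f := L) hlt)
  have hL : ∀ k : {k : Fin n // k ≠ i}, inner ℝ (f k) v = 0 := fun k =>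
    congrFun (LinearMap.mem_ker.1 hv) k
  refine ⟨v, hv0, fun k hk => ?_, fun k hk => ?_⟩
  · simpa [f, hk] using hL ⟨k, hk.ne'⟩
  · simpa [f, hk.not_gt] using hL ⟨k.rev, hk.ne⟩

theorem le_mul_of_monotone_eigenvalues {A B : Matrix (Fin n) (Fin n) ℝ} {c : ℝ} (hc : 0 ≤ c)
    (hA : A.PosDef) (hB : B.IsHermitian) (hAB : (B - c • A⁻¹).PosSemidef)
    (σ τ : Equiv.Perm (Fin n)) (hσ : Monotone (hA.1.eigenvalues ∘ σ))
    (hτ : Monotone (hB.eigenvalues ∘ τ)) (i : Fin n) :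
    c ≤ hA.1.eigenvalues (σ i) * hB.eigenvalues (τ i.rev) := by
  obtain ⟨v, hv0, hvA, hvB⟩ := exists_ne_zero_inner_eq_zero
    (fun k => hA.1.eigenvectorBasis (σ k)) (fun k => hB.eigenvectorBasis (τ k)) i
  set μ := hA.1.eigenvalues (σ i)
  have hμ : 0 < μ := hA.eigenvalues_pos _
  have hinv : ∀ k, A⁻¹ *ᵥ (hA.1.eigenvectorBasis k).ofLp
      = (hA.1.eigenvalues k)⁻¹ • (hA.1.eigenvectorBasis k).ofLp := by
    intro k
    have hk := (hA.eigenvalues_pos k).ne'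
    have hdet : IsUnit A.det := hA.det_pos.ne'.isUnit
    rw [eq_inv_smul_iff₀ hk, ← mulVec_smul, ← hA.1.mulVec_eigenvectorBasis, mulVec_mulVec,
      nonsing_inv_mul _ hdet, one_mulVec]
  have hnorm : ∀ b : OrthonormalBasis (Fin n) ℝ (EuclideanSpace ℝ (Fin n)),
      ∑ k, inner ℝ (b k) v ^ 2 = ‖v‖ ^ 2 := by
    intro b
    simpa using b.sum_sq_norm_inner_right v
  have hAv : μ⁻¹ * ‖v‖ ^ 2 ≤ v.ofLp ⬝ᵥ A⁻¹ *ᵥ v.ofLp := by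
    rw [dotProduct_mulVec_eq_sum_of_orthonormal_eigenvectors
      (hA.1.eigenvectorBasis.reindex σ.symm) (lam := fun k => (hA.1.eigenvalues (σ k))⁻¹)
      (by simpa [IsHermitian, IsSymm] using hA.inv.1) (by simp [hinv]),
      ← hnorm (hA.1.eigenvectorBasis.reindex σ.symm), Finset.mul_sum]
    simp only [OrthonormalBasis.reindex_apply, Equiv.symm_symm]
    refine Finset.sum_le_sum fun k _ => ?_
    rcases lt_or_ge i k with h | h
    · simp [hvA k h]
    · exact mul_le_mul_of_nonneg_right (inv_anti₀ (hA.eigenvalues_pos _) (hσ h)) (sq_nonneg _)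
  have hBv : v.ofLp ⬝ᵥ B *ᵥ v.ofLp ≤ hB.eigenvalues (τ i.rev) * ‖v‖ ^ 2 := by
    rw [dotProduct_mulVec_eq_sum_of_orthonormal_eigenvectors
      (hB.eigenvectorBasis.reindex τ.symm) (lam := fun k => hB.eigenvalues (τ k))
      (by simpa [IsHermitian, IsSymm] using hB) (by simp [hB.mulVec_eigenvectorBasis]),
      ← hnorm (hB.eigenvectorBasis.reindex τ.symm), Finset.mul_sum]
    simp only [OrthonormalBasis.reindex_apply, Equiv.symm_symm]
    refine Finset.sum_le_sum fun k _ => ?_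
    rcases lt_or_ge k.rev i with h | h
    · simp [hvB k h]
    · exact mul_le_mul_of_nonneg_right (hτ (Fin.le_rev_iff.2 h)) (sq_nonneg _)
  have hpos := hAB.dotProduct_mulVec_nonneg v.ofLp
  rw [star_trivial, sub_mulVec, smul_mulVec, dotProduct_sub, dotProduct_smul, smul_eq_mul] at hpos
  have hv : 0 < ‖v‖ ^ 2 := by positivity
  have hle : c * μ⁻¹ ≤ hB.eigenvalues (τ i.rev) := by
    refine le_of_mul_le_mul_right ?_ hv
    nlinarith [mul_le_mul_of_nonneg_left hAv hc]
  rwa [← div_eq_mul_inv, div_le_iff₀' hμ] at hle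

theorem eigenvalues_eq_const_iff {A : Matrix (Fin n) (Fin n) ℝ} (hA : A.IsHermitian) (a : ℝ) :
    (∀ i, hA.eigenvalues i = a) ↔ A = a • 1 := by
  constructor
  · intro h
    have hdiag : diagonal (RCLike.ofReal ∘ hA.eigenvalues) = a • (1 : Matrix (Fin n) (Fin n) ℝ) := by
      rw [smul_one_eq_diagonal]
      congr 1
      ext i
      simp [h i]
    have hs := hA.spectral_theorem
    rw [hdiag, map_smul, map_one] at hs
    exact hs
  · intro h i
    have hi := hA.mulVec_eigenvectorBasis i
    have hne : (hA.eigenvectorBasis i).ofLp ≠ 0 := fun h0 =>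
      hA.eigenvectorBasis.toBasis.ne_zero i (by ext1; simp [h0])
    have heq : ∀ w, A *ᵥ w = a • w := fun w => by
      rw [h, smul_mulVec, one_mulVec]
    exact (smul_left_injective ℝ hne ((heq _).symm.trans hi)).symm

end Matrix

/-- Vector-case optimization: for thresholds `ε₁ε₂ ≥ ħ²/4` and real symmetric
positive definite noise covariance matrices `A`, `B` with `B − (ħ²/4)A⁻¹` positive semidefinite,
the sum `∑ᵢ s(μᵢ/ε₁) + ∑ᵢ s(νᵢ/ε₂)` over the eigenvalues `μᵢ` of `A` and `νᵢ` of `B` is at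
least `2·n·s(ħ/(2√(ε₁ε₂)))`, with equality iff `A = (ħ/2)√(ε₁/ε₂)·I` and
`B = (ħ/2)√(ε₂/ε₁)·I`. -/
theorem stmt_19 {n : ℕ} (hbar ε₁ ε₂ : ℝ) (hhbar : 0 < hbar)
    (hε₁ : 0 < ε₁) (hε₂ : 0 < ε₂) (hεε : hbar ^ 2 / 4 ≤ ε₁ * ε₂)
    (A B : Matrix (Fin n) (Fin n) ℝ) (hA : A.PosDef) (hB : B.PosDef)
    (hAB : (B - (hbar ^ 2 / 4) • A⁻¹).PosSemidef) :
    2 * (n : ℝ) * sFun (hbar / (2 * Real.sqrt (ε₁ * ε₂))) ≤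
        (∑ i, sFun (hA.1.eigenvalues i / ε₁)) + ∑ i, sFun (hB.1.eigenvalues i / ε₂) ∧
      ((∑ i, sFun (hA.1.eigenvalues i / ε₁)) + ∑ i, sFun (hB.1.eigenvalues i / ε₂) =
          2 * (n : ℝ) * sFun (hbar / (2 * Real.sqrt (ε₁ * ε₂))) ↔
        A = (hbar / 2 * Real.sqrt (ε₁ / ε₂)) • 1 ∧ B = (hbar / 2 * Real.sqrt (ε₂ / ε₁)) • 1) := by
  set t := hbar / (2 * √(ε₁ * ε₂)) with ht_def
  have ht : 0 < t := by positivity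
  have ht₁ : ε₁ * t = hbar / 2 * √(ε₁ / ε₂) := by
    have h₁ := Real.sq_sqrt hε₁.le
    rw [ht_def, Real.sqrt_mul hε₁.le, Real.sqrt_div hε₁.le]
    field_simp
    linear_combination -h₁
  have ht₂ : ε₂ * t = hbar / 2 * √(ε₂ / ε₁) := by
    have h₂ := Real.sq_sqrt hε₂.le
    rw [ht_def, Real.sqrt_mul hε₁.le, Real.sqrt_div hε₂.le]
    field_simp
    linear_combination -h₂
  have ht_sq : t ^ 2 = hbar ^ 2 / 4 / (ε₁ * ε₂) := by
    rw [ht_def, div_pow, mul_pow, Real.sq_sqrt (by positivity)]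
    ring
  let σ := Tuple.sort hA.1.eigenvalues
  let τ := Fin.revPerm.trans (Tuple.sort hB.1.eigenvalues)
  let x : Fin n → ℝ := fun i => hA.1.eigenvalues (σ i) / ε₁
  let y : Fin n → ℝ := fun i => hB.1.eigenvalues (τ i) / ε₂
  have hx : ∀ i, 0 < x i := fun i => div_pos (hA.eigenvalues_pos _) hε₁
  have hy : ∀ i, 0 < y i := fun i => div_pos (hB.eigenvalues_pos _) hε₂
  have hxy : ∀ i, t ^ 2 ≤ x i * y i := by
    intro i
    rw [ht_sq, div_mul_div_comm]
    gcongr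
    exact le_mul_of_monotone_eigenvalues (by positivity) hA hB.1 hAB σ
      (Tuple.sort hB.1.eigenvalues) (Tuple.monotone_sort _) (Tuple.monotone_sort _) i
  have hle : ∀ i, 2 * sFun t ≤ sFun (x i) + sFun (y i) := fun i =>
    two_mul_sFun_le_add_of_sq_le_mul ht (hx i) (hy i) (hxy i)
  have hsum : (∑ i, sFun (hA.1.eigenvalues i / ε₁)) + ∑ i, sFun (hB.1.eigenvalues i / ε₂)
      = ∑ i, (sFun (x i) + sFun (y i)) := by
    rw [Finset.sum_add_distrib, ← Equiv.sum_comp σ, ← Equiv.sum_comp τ (fun i => sFun (_ / ε₂))]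
  have hconst : 2 * (n : ℝ) * sFun t = ∑ _i : Fin n, 2 * sFun t := by
    simp
    ring
  have hiff : ∀ i, 2 * sFun t = sFun (x i) + sFun (y i) ↔ x i = t ∧ y i = t := fun i =>
    ⟨fun h => by_contra fun hne =>
      (two_mul_sFun_lt_add_of_sq_le_mul ht (hx i) (hy i) (hxy i) hne).ne h,
      fun h => by rw [h.1, h.2, two_mul]⟩
  rw [hsum, hconst, eq_comm, Finset.sum_eq_sum_iff_of_le fun i _ => hle i]
  refine ⟨Finset.sum_le_sum fun i _ => hle i, ?_⟩
  rw [← ht₁, ← ht₂, ← eigenvalues_eq_const_iff hA.1, ← eigenvalues_eq_const_iff hB.1]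
  simp only [Finset.mem_univ, true_imp_iff, hiff, forall_and]
  rw [← σ.forall_congr_right (q := fun i => hA.1.eigenvalues i = _),
    ← τ.forall_congr_right (q := fun i => hB.1.eigenvalues i = _)]
  simp only [x, y, div_eq_iff hε₁.ne', div_eq_iff hε₂.ne', mul_comm t]
end
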